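/- Let w be a scalar A_∞ weight on ℝⁿ, defined by the Fujii–Wilson condition [w]* := sup_Q (1/w(Q)) ∫_Q M(w 1_Q)(x) dx < ∞, where M is the Hardy–Littlewood maximal operator. Then for every r ∈ [1, 1 + 1/(2^{n+1}[w]* − 1)] and every cube Q, (⨍_Q w(x)^r dx) ≤ 2 (⨍_Q w(x) dx)^r. -/

import Mathlib

open MeasureTheory ENNReal

/-- An axis-parallel cube in `ℝⁿ` (here realized as a closed cube with positive edge length). -/
def IsCube {n : ℕ} (Q : Set (Fin n → ℝ)) : Prop :=
  ∃ (a : Fin n → ℝ) (l : ℝ), 0 < l ∧ Q = Set.Icc a (fun i => a i + l)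

/-- The Euclidean norm on `ℝⁿ` realized as `Fin n → ℝ`. -/
noncomputable def euclNorm {n : ℕ} (x : Fin n → ℝ) : ℝ :=
  Real.sqrt (∑ i, x i ^ 2)

/-- The Euclidean ball of center `c` and radius `r`. -/
def euclBall {n : ℕ} (c : Fin n → ℝ) (r : ℝ) : Set (Fin n → ℝ) :=
  {y | euclNorm (y - c) < r}

/-- The Hardy–Littlewood maximal function `M f (x) = sup_{ball B ∋ x} ⨍_B |f|`. -/
noncomputable def HLMax {n : ℕ} (f : (Fin n → ℝ) → ℝ) (x : Fin n → ℝ) : ℝ≥0∞ :=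
  ⨆ (c : Fin n → ℝ) (r : ℝ) (_ : 0 < r) (_ : x ∈ euclBall c r),
    (volume (euclBall c r))⁻¹ * ∫⁻ y in euclBall c r, ENNReal.ofReal |f y|

/-- The running maximum of a sequence of functions. -/
def runMax {α : Type*} (X : ℕ → α → ℝ) : ℕ → α → ℝ
  | 0 => X 0
  | m + 1 => fun x => max (runMax X m x) (X (m + 1) x)

section RunMax

variable {α : Type*} {X Y : ℕ → α → ℝ}

lemma le_runMax {j m : ℕ} (h : j ≤ m) (x : α) : X j x ≤ runMax X m x := by
  induction m with
  | zero => obtain rfl : j = 0 := by omega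
            exact le_rfl
  | succ m ih =>
    rcases Nat.lt_or_ge j (m + 1) with h' | h'
    · exact (ih (by omega)).trans (le_max_left _ _)
    · obtain rfl : j = m + 1 := by omega
      exact le_max_right _ _

lemma runMax_le {m : ℕ} {x : α} {t : ℝ} (h : ∀ j ≤ m, X j x ≤ t) : runMax X m x ≤ t := by
  induction m with
  | zero => exact h 0 le_rfl
  | succ m ih => exact max_le (ih fun j hj => h j (by omega)) (h _ le_rfl)

lemma runMax_mono {m m' : ℕ} (h : m ≤ m') (x : α) : runMax X m x ≤ runMax X m' x :=
  runMax_le fun _ hj => le_runMax (hj.trans h) x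

lemma runMax_add (i m : ℕ) (x : α) :
    runMax X (i + m) x = max (runMax X i x) (runMax (fun j => X (i + j)) m x) := by
  induction m with
  | zero =>
    exact (max_eq_left (le_runMax le_rfl x)).symm
  | succ m ih =>
    change max (runMax X (i + m) x) _ = max _ (max _ _)
    rw [ih, max_assoc]
    rfl

lemma runMax_congr {m : ℕ} {x y : α} (h : ∀ j ≤ m, X j x = X j y) :
    runMax X m x = runMax X m y := by
  induction m with
  | zero => exact h 0 le_rfl
  | succ m ih =>
    change max _ _ = max _ _
    rw [ih fun j hj => h j (by omega), h _ le_rfl]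

end RunMax

/-- The cell at level `k` containing `x` of the partitions given by the index maps `π`. -/
def cell {α ι : Type*} (π : ℕ → α → ι) (k : ℕ) (x : α) : Set α := {y | π k y = π k x}

/-- The average of `W` over `S`, as a real number. -/
noncomputable def setAvg {α : Type*} [MeasurableSpace α] (μ : Measure α) (W : α → ℝ≥0∞)
    (S : Set α) : ℝ :=
  (∫⁻ y in S, W y ∂μ).toReal / (μ S).toReal

/-- The average of `W` over the cell at level `k` containing `x`. -/
noncomputable def cellAvg {α ι : Type*} [MeasurableSpace α] (μ : Measure α) (W : α → ℝ≥0∞)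
    (π : ℕ → α → ι) (k : ℕ) (x : α) : ℝ :=
  setAvg μ W (cell π k x)

/-- A refining sequence of countable measurable partitions into cells of positive finite measure
and positive finite mass, in which the measure drops by a factor at most `D` at each step. -/
structure CellFiltration {α ι : Type*} [MeasurableSpace α] (μ : Measure α) (W : α → ℝ≥0∞)
    (D : ℝ) (π : ℕ → α → ι) : Prop where
  meas : ∀ k j, MeasurableSet (π k ⁻¹' {j})
  refines : ∀ k x y, π (k + 1) x = π (k + 1) y → π k x = π k y
  vol_ne_zero : ∀ k x, μ (cell π k x) ≠ 0
  vol_ne_top : ∀ k x, μ (cell π k x) ≠ ∞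
  mass_ne_zero : ∀ k x, ∫⁻ y in cell π k x, W y ∂μ ≠ 0
  mass_ne_top : ∀ k x, ∫⁻ y in cell π k x, W y ∂μ ≠ ∞
  vol_le : ∀ k x, μ (cell π k x) ≤ ENNReal.ofReal D * μ (cell π (k + 1) x)

section Cells

variable {α ι : Type*} {π : ℕ → α → ι}

lemma mem_cell_self (k : ℕ) (x : α) : x ∈ cell π k x := rfl

lemma cell_eq {k : ℕ} {x y : α} (h : y ∈ cell π k x) : cell π k y = cell π k x := by
  have h' : π k y = π k x := h
  simp [cell, h']

end Cells

namespace CellFiltration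

variable {α ι : Type*} [MeasurableSpace α] {μ : Measure α} {W : α → ℝ≥0∞} {D : ℝ}
  {π : ℕ → α → ι}

lemma shift (F : CellFiltration μ W D π) (k : ℕ) :
    CellFiltration μ W D (fun j => π (k + j)) where
  meas j := F.meas (k + j)
  refines j := F.refines (k + j)
  vol_ne_zero j := F.vol_ne_zero (k + j)
  vol_ne_top j := F.vol_ne_top (k + j)
  mass_ne_zero j := F.mass_ne_zero (k + j)
  mass_ne_top j := F.mass_ne_top (k + j)
  vol_le j := F.vol_le (k + j)

lemma measurableSet_cell (F : CellFiltration μ W D π) (k : ℕ) (x : α) :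
    MeasurableSet (cell π k x) := F.meas k (π k x)

lemma cell_subset (F : CellFiltration μ W D π) {i k : ℕ} (h : i ≤ k) (x : α) :
    cell π k x ⊆ cell π i x := by
  induction k, h using Nat.le_induction with
  | base => exact subset_rfl
  | succ k _ ih => exact fun y hy => ih (F.refines k y x hy)

lemma cellAvg_congr (F : CellFiltration μ W D π) {i k : ℕ} (h : i ≤ k) {x y : α}
    (hy : y ∈ cell π k x) : cellAvg μ W π i y = cellAvg μ W π i x := by
  rw [cellAvg, cell_eq (F.cell_subset h x hy), cellAvg]

lemma runMax_congr_cell (F : CellFiltration μ W D π) {i k : ℕ} (h : i ≤ k) {x y : α}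
    (hy : y ∈ cell π k x) :
    runMax (cellAvg μ W π) i y = runMax (cellAvg μ W π) i x :=
  runMax_congr fun _ hj => F.cellAvg_congr (hj.trans h) hy

lemma cellAvg_pos (F : CellFiltration μ W D π) (k : ℕ) (x : α) : 0 < cellAvg μ W π k x :=
  div_pos (ENNReal.toReal_pos (F.mass_ne_zero k x) (F.mass_ne_top k x))
    (ENNReal.toReal_pos (F.vol_ne_zero k x) (F.vol_ne_top k x))

lemma runMax_pos (F : CellFiltration μ W D π) (k : ℕ) (x : α) :
    0 < runMax (cellAvg μ W π) k x :=
  (F.cellAvg_pos 0 x).trans_le (le_runMax (Nat.zero_le k) x)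

lemma ofReal_cellAvg_mul (F : CellFiltration μ W D π) (k : ℕ) (x : α) :
    ENNReal.ofReal (cellAvg μ W π k x) * μ (cell π k x) = ∫⁻ y in cell π k x, W y ∂μ := by
  have hv := ENNReal.toReal_pos (F.vol_ne_zero k x) (F.vol_ne_top k x)
  conv_lhs => rw [← ENNReal.ofReal_toReal (F.vol_ne_top k x)]
  rw [← ENNReal.ofReal_mul (F.cellAvg_pos k x).le, cellAvg, setAvg, div_mul_cancel₀ _ hv.ne',
    ENNReal.ofReal_toReal (F.mass_ne_top k x)]

lemma cellAvg_succ_le (F : CellFiltration μ W D π) (hD : 0 ≤ D) (k : ℕ) (x : α) :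
    cellAvg μ W π (k + 1) x ≤ D * cellAvg μ W π k x := by
  have hv := ENNReal.toReal_pos (F.vol_ne_zero k x) (F.vol_ne_top k x)
  have hv' := ENNReal.toReal_pos (F.vol_ne_zero (k + 1) x) (F.vol_ne_top (k + 1) x)
  have h1 : (∫⁻ y in cell π (k + 1) x, W y ∂μ).toReal ≤ (∫⁻ y in cell π k x, W y ∂μ).toReal :=
    ENNReal.toReal_mono (F.mass_ne_top k x)
      (lintegral_mono_set (F.cell_subset (Nat.le_succ k) x))
  have h2 : (μ (cell π k x)).toReal ≤ D * (μ (cell π (k + 1) x)).toReal := by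
    have := ENNReal.toReal_mono
      (ENNReal.mul_ne_top ENNReal.ofReal_ne_top (F.vol_ne_top (k + 1) x)) (F.vol_le k x)
    rwa [ENNReal.toReal_mul, ENNReal.toReal_ofReal hD] at this
  have h3 : 0 ≤ (∫⁻ y in cell π k x, W y ∂μ).toReal := ENNReal.toReal_nonneg
  simp only [cellAvg, setAvg]
  rw [div_le_iff₀ hv', mul_div_assoc', div_mul_eq_mul_div, le_div_iff₀ hv]
  nlinarith

lemma runMax_succ_le (F : CellFiltration μ W D π) (hD : 1 ≤ D) (k : ℕ) (x : α) :
    runMax (cellAvg μ W π) (k + 1) x ≤ D * runMax (cellAvg μ W π) k x := by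
  have h0 := (F.runMax_pos k x).le
  refine max_le (le_mul_of_one_le_left h0 hD) ((F.cellAvg_succ_le (by linarith) k x).trans ?_)
  exact mul_le_mul_of_nonneg_left (le_runMax le_rfl x) (by linarith)

lemma runMax_le_pow (F : CellFiltration μ W D π) (hD : 1 ≤ D) (k : ℕ) (x : α) :
    runMax (cellAvg μ W π) k x ≤ D ^ k * cellAvg μ W π 0 x := by
  induction k with
  | zero => simp [runMax]
  | succ k ih =>
    calc _ ≤ D * runMax (cellAvg μ W π) k x := F.runMax_succ_le hD k x
      _ ≤ D * (D ^ k * cellAvg μ W π 0 x) := mul_le_mul_of_nonneg_left ih (by linarith)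
      _ = _ := by ring

lemma cell_saturated (F : CellFiltration μ W D π) {i k : ℕ} (h : i ≤ k) (x : α) :
    ∀ y ∈ cell π i x, cell π k y ⊆ cell π i x :=
  fun y hy => (F.cell_subset h y).trans (cell_eq hy).subset

variable [Countable ι]

lemma measurable_of_congr (F : CellFiltration μ W D π) {β : Type*} [MeasurableSpace β] (k : ℕ)
    {g : α → β} (hg : ∀ x, ∀ y ∈ cell π k x, g y = g x) : Measurable g := by
  intro s _
  have : g ⁻¹' s = ⋃ j ∈ π k '' (g ⁻¹' s), π k ⁻¹' {j} := by
    ext y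
    simp only [Set.mem_preimage, Set.mem_iUnion, Set.mem_image, Set.mem_singleton_iff]
    constructor
    · exact fun hy => ⟨π k y, ⟨y, hy, rfl⟩, rfl⟩
    · rintro ⟨j, ⟨x, hx, rfl⟩, hj⟩
      rwa [hg x y hj]
  rw [this]
  exact MeasurableSet.biUnion (Set.to_countable _) fun j _ => F.meas k j

lemma measurable_cellAvg (F : CellFiltration μ W D π) (k : ℕ) : Measurable (cellAvg μ W π k) :=
  F.measurable_of_congr k fun _ _ => F.cellAvg_congr le_rfl

lemma measurable_runMax (F : CellFiltration μ W D π) (k : ℕ) :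
    Measurable (runMax (cellAvg μ W π) k) :=
  F.measurable_of_congr k fun _ _ => F.runMax_congr_cell le_rfl

/-- A set which is a union of cells is measurable. -/
lemma measurableSet_of_saturated (F : CellFiltration μ W D π) (k : ℕ) {S : Set α}
    (hS : ∀ x ∈ S, cell π k x ⊆ S) : MeasurableSet S := by
  have : S = ⋃ j ∈ π k '' S, π k ⁻¹' {j} := by
    ext y
    simp only [Set.mem_iUnion, Set.mem_image, Set.mem_preimage, Set.mem_singleton_iff]
    constructor
    · exact fun hy => ⟨π k y, ⟨y, hy, rfl⟩, rfl⟩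
    · rintro ⟨j, ⟨x, hx, rfl⟩, hj⟩
      exact hS x hx hj
  rw [this]
  exact MeasurableSet.biUnion (Set.to_countable _) fun j _ => F.meas k j

/-- An inequality between integrals over a union of cells can be checked on each cell. -/
lemma lintegral_le_of_cells (F : CellFiltration μ W D π) (k : ℕ) {S : Set α}
    (hS : ∀ x ∈ S, cell π k x ⊆ S) {f g : α → ℝ≥0∞}
    (h : ∀ x ∈ S, ∫⁻ y in cell π k x, f y ∂μ ≤ ∫⁻ y in cell π k x, g y ∂μ) :
    ∫⁻ y in S, f y ∂μ ≤ ∫⁻ y in S, g y ∂μ := by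
  have hU : S = ⋃ j, S ∩ π k ⁻¹' {j} := by
    ext y; simp
  have hmS := F.measurableSet_of_saturated k hS
  have hm : ∀ j, MeasurableSet (S ∩ π k ⁻¹' {j}) := fun j => hmS.inter (F.meas k j)
  have hd : Pairwise (Function.onFun Disjoint fun j => S ∩ π k ⁻¹' {j}) := by
    intro i j hij
    refine Set.disjoint_left.2 ?_
    rintro y ⟨_, h1⟩ ⟨_, h2⟩
    exact hij (h1.symm.trans h2)
  rw [hU, lintegral_iUnion hm hd, lintegral_iUnion hm hd]
  refine ENNReal.tsum_le_tsum fun j => ?_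
  rcases Set.eq_empty_or_nonempty (S ∩ π k ⁻¹' {j}) with h0 | ⟨x, hx, hxj⟩
  · simp [h0]
  · have : S ∩ π k ⁻¹' {j} = cell π k x := by
      have hxj' : π k x = j := hxj
      subst hxj'
      exact Set.inter_eq_right.2 (hS x hx)
    rw [this]
    exact h x hx

/-- The maximal function controls the entropy of `W`: the martingale form of the
`L log L` inequality, with constant adapted to the regularity of the filtration. -/
lemma lintegral_log_runMax_le (F : CellFiltration μ W 2 π) (hW : Measurable W) (x : α) (N : ℕ) :
    ENNReal.ofReal (2 * Real.log 2) * ∫⁻ y in cell π 0 x, W y ∂μ +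
      ∫⁻ y in cell π 0 x, W y * ENNReal.ofReal
        (Real.log (runMax (cellAvg μ W π) N y / cellAvg μ W π 0 y)) ∂μ ≤
      ENNReal.ofReal (2 * Real.log 2) *
        ∫⁻ y in cell π 0 x, ENNReal.ofReal (runMax (cellAvg μ W π) N y) ∂μ := by
  set X := cellAvg μ W π with hX
  have hl2 : 0 < 2 * Real.log 2 := mul_pos two_pos (Real.log_pos one_lt_two)
  induction N with
  | zero =>
    have h0 : ∀ y, Real.log (runMax X 0 y / X 0 y) = 0 := fun y => by
      rw [runMax, div_self (F.cellAvg_pos 0 y).ne', Real.log_one]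
    simp only [h0, ENNReal.ofReal_zero, mul_zero, lintegral_zero, add_zero]
    gcongr ENNReal.ofReal _ * ?_
    rw [← F.ofReal_cellAvg_mul 0 x, setLIntegral_congr_fun (F.measurableSet_cell 0 x)
      (g := fun _ => ENNReal.ofReal (X 0 x))
      (fun y hy => by simp only [runMax]; rw [hX, F.cellAvg_congr le_rfl hy])]
    simp [hX]
  | succ N ih =>
    have hM := F.measurable_runMax (μ := μ) (W := W)
    have hlog : ∀ y, Real.log (runMax X (N + 1) y / X 0 y) =
        Real.log (runMax X N y / X 0 y) + Real.log (runMax X (N + 1) y / runMax X N y) := by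
      intro y
      have h1 := F.runMax_pos N y
      have h2 := F.runMax_pos (N + 1) y
      have h3 := F.cellAvg_pos 0 y
      rw [Real.log_div h2.ne' h3.ne', Real.log_div h1.ne' h3.ne', Real.log_div h2.ne' h1.ne']
      ring
    have hn1 : ∀ y, 0 ≤ Real.log (runMax X N y / X 0 y) := fun y =>
      Real.log_nonneg ((one_le_div (F.cellAvg_pos 0 y)).2 (le_runMax (Nat.zero_le N) y))
    have hn2 : ∀ y, 0 ≤ Real.log (runMax X (N + 1) y / runMax X N y) := fun y =>
      Real.log_nonneg ((one_le_div (F.runMax_pos N y)).2 (runMax_mono (Nat.le_succ N) y))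
    have hsplit : ∫⁻ y in cell π 0 x, W y * ENNReal.ofReal
          (Real.log (runMax X (N + 1) y / X 0 y)) ∂μ =
        ∫⁻ y in cell π 0 x, W y * ENNReal.ofReal (Real.log (runMax X N y / X 0 y)) ∂μ +
        ∫⁻ y in cell π 0 x, W y * ENNReal.ofReal
          (Real.log (runMax X (N + 1) y / runMax X N y)) ∂μ := by
      rw [← lintegral_add_left]
      · refine lintegral_congr fun y => ?_
        rw [hlog, ENNReal.ofReal_add (hn1 y) (hn2 y), mul_add]
      · exact hW.mul (((hM N).div (F.measurable_cellAvg 0)).log.ennreal_ofReal)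
    have hstep : ∫⁻ y in cell π 0 x, W y * ENNReal.ofReal
          (Real.log (runMax X (N + 1) y / runMax X N y)) ∂μ ≤
        ENNReal.ofReal (2 * Real.log 2) * ∫⁻ y in cell π 0 x,
          ENNReal.ofReal (runMax X (N + 1) y - runMax X N y) ∂μ := by
      rw [← lintegral_const_mul' _ _ ENNReal.ofReal_ne_top]
      refine F.lintegral_le_of_cells (N + 1) (F.cell_saturated (Nat.zero_le _) x) fun z _ => ?_
      have hc : ∀ y ∈ cell π (N + 1) z, runMax X (N + 1) y = runMax X (N + 1) z ∧
          runMax X N y = runMax X N z := fun y hy =>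
        ⟨F.runMax_congr_cell le_rfl hy, F.runMax_congr_cell (Nat.le_succ N) hy⟩
      have hl : ∫⁻ y in cell π (N + 1) z, W y * ENNReal.ofReal
            (Real.log (runMax X (N + 1) y / runMax X N y)) ∂μ =
          ∫⁻ y in cell π (N + 1) z, W y * ENNReal.ofReal
            (Real.log (runMax X (N + 1) z / runMax X N z)) ∂μ :=
        setLIntegral_congr_fun (F.measurableSet_cell _ z)
          (fun y hy => by simp only [(hc y hy).1, (hc y hy).2])
      have hr : ∫⁻ y in cell π (N + 1) z, ENNReal.ofReal (2 * Real.log 2) *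
            ENNReal.ofReal (runMax X (N + 1) y - runMax X N y) ∂μ =
          ∫⁻ _ in cell π (N + 1) z, ENNReal.ofReal (2 * Real.log 2) *
            ENNReal.ofReal (runMax X (N + 1) z - runMax X N z) ∂μ :=
        setLIntegral_congr_fun (F.measurableSet_cell _ z)
          (fun y hy => by simp only [(hc y hy).1, (hc y hy).2])
      rw [hl, hr, lintegral_mul_const' _ _ ENNReal.ofReal_ne_top, setLIntegral_const,
        ← F.ofReal_cellAvg_mul, mul_right_comm, ← ENNReal.ofReal_mul (F.cellAvg_pos _ _).le,
        ← ENNReal.ofReal_mul hl2.le]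
      refine mul_le_mul_left (ENNReal.ofReal_le_ofReal ?_) _
      have hp := F.runMax_pos (μ := μ) (W := W) N z
      have hle : runMax X (N + 1) z ≤ 2 * runMax X N z := F.runMax_succ_le one_le_two N z
      rcases le_or_gt (X (N + 1) z) (runMax X N z) with h | h
      · have : runMax X (N + 1) z = runMax X N z := max_eq_left h
        rw [this, div_self hp.ne']
        simp
      · have hm : runMax X (N + 1) z = X (N + 1) z := max_eq_right h.le
        rw [← hX, hm]
        rw [hm] at hle
        -- with `u` the ratio, this is concavity of `log` on `[1/2, 1]`
        set p := runMax X N z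
        set q := X (N + 1) z
        have hq : 0 < q := hp.trans h
        have hu1 : 1 / 2 ≤ p / q := by rw [div_le_div_iff₀ two_pos hq]; linarith
        have hu2 : p / q ≤ 1 := (div_le_one hq).2 h.le
        have hconc : (2 * (1 - p / q)) * Real.log (1 / 2) + (2 * (p / q) - 1) * Real.log 1 ≤
            Real.log (p / q) := by
          have hx : (1 / 2 : ℝ) ∈ Set.Ioi (0 : ℝ) := Set.mem_Ioi.2 (by norm_num)
          have hy : (1 : ℝ) ∈ Set.Ioi (0 : ℝ) := Set.mem_Ioi.2 one_pos
          have := strictConcaveOn_log_Ioi.concaveOn.2 hx hy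
            (by linarith : 0 ≤ 2 * (1 - p / q)) (by linarith : 0 ≤ 2 * (p / q) - 1) (by ring)
          simp only [smul_eq_mul] at this
          rwa [show 2 * (1 - p / q) * (1 / 2) + (2 * (p / q) - 1) * 1 = p / q by ring] at this
        have hlog1 : Real.log (q / p) = -Real.log (p / q) := by rw [← Real.log_inv, inv_div]
        rw [Real.log_one, one_div, Real.log_inv] at hconc
        have : Real.log (q / p) ≤ 2 * Real.log 2 * (1 - p / q) := by rw [hlog1]; linarith
        calc q * Real.log (q / p) ≤ q * (2 * Real.log 2 * (1 - p / q)) := by gcongr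
          _ = 2 * Real.log 2 * (q - p) := by field_simp
    have hfin : ∫⁻ y in cell π 0 x, ENNReal.ofReal (runMax X (N + 1) y) ∂μ =
        ∫⁻ y in cell π 0 x, ENNReal.ofReal (runMax X N y) ∂μ +
        ∫⁻ y in cell π 0 x, ENNReal.ofReal (runMax X (N + 1) y - runMax X N y) ∂μ := by
      rw [← lintegral_add_left (hM N).ennreal_ofReal]
      refine lintegral_congr fun y => ?_
      rw [← ENNReal.ofReal_add (F.runMax_pos N y).le
        (sub_nonneg.2 (runMax_mono (Nat.le_succ N) y)), add_sub_cancel]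
    rw [hsplit, hfin, mul_add, ← add_assoc]
    exact add_le_add ih hstep

/-- Weak type bound for the maximal function of a cell. -/
lemma ofReal_mul_measure_le (F : CellFiltration μ W D π) (x : α) (t : ℝ) (N : ℕ) :
    ENNReal.ofReal t * μ (cell π 0 x ∩ {y | t ≤ runMax (cellAvg μ W π) N y}) ≤
      ∫⁻ y in cell π 0 x, W y ∂μ := by
  set X := cellAvg μ W π with hX
  have hM := F.measurable_runMax (μ := μ) (W := W)
  have key : ∀ k, ∀ S : Set α, (∀ z ∈ S, cell π k z ⊆ S) → (∀ z ∈ S, t ≤ X k z) →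
      ∫⁻ _ in S, ENNReal.ofReal t ∂μ ≤ ∫⁻ y in S, W y ∂μ := by
    intro k S hS ht
    refine F.lintegral_le_of_cells k hS fun z hz => ?_
    rw [setLIntegral_const, ← F.ofReal_cellAvg_mul]
    gcongr
    exact ht z hz
  have hE : ∀ N, ∫⁻ _ in cell π 0 x ∩ {y | t ≤ runMax X N y}, ENNReal.ofReal t ∂μ ≤
      ∫⁻ y in cell π 0 x ∩ {y | t ≤ runMax X N y}, W y ∂μ := by
    intro N
    induction N with
    | zero =>
      refine key 0 _ ?_ fun z hz => hz.2
      rintro z ⟨hz, hz'⟩ y hy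
      exact ⟨F.cell_saturated le_rfl x z hz hy, hz'.trans (F.runMax_congr_cell le_rfl hy).ge⟩
    | succ N ih =>
      have hU : cell π 0 x ∩ {y | t ≤ runMax X (N + 1) y} =
          (cell π 0 x ∩ {y | t ≤ runMax X N y}) ∪
          (cell π 0 x ∩ {y | runMax X N y < t ∧ t ≤ X (N + 1) y}) := by
        ext y
        simp only [Set.mem_inter_iff, Set.mem_ofPred_eq, Set.mem_union, runMax, le_max_iff]
        by_cases h : t ≤ runMax X N y
        · simp [h]
        · simp [h, not_le.1 h]
      have hsat : ∀ z ∈ cell π 0 x ∩ {y | runMax X N y < t ∧ t ≤ X (N + 1) y},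
          cell π (N + 1) z ⊆ cell π 0 x ∩ {y | runMax X N y < t ∧ t ≤ X (N + 1) y} := by
        rintro z ⟨hz, hz1, hz2⟩ y hy
        refine ⟨F.cell_saturated (Nat.zero_le _) x z hz hy, ?_, ?_⟩
        · rwa [F.runMax_congr_cell (Nat.le_succ N) hy]
        · rwa [hX, F.cellAvg_congr le_rfl hy]
      have hdisj : Disjoint (cell π 0 x ∩ {y | t ≤ runMax X N y})
          (cell π 0 x ∩ {y | runMax X N y < t ∧ t ≤ X (N + 1) y}) :=
        Set.disjoint_left.2 fun y h1 h2 => absurd h1.2 (not_le.2 h2.2.1)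
      have hms := F.measurableSet_of_saturated (N + 1) hsat
      rw [hU, lintegral_union hms hdisj, lintegral_union hms hdisj]
      exact add_le_add ih (key (N + 1) _ hsat fun z hz => hz.2.2)
  have := hE N
  rw [setLIntegral_const] at this
  exact this.trans (lintegral_mono_set Set.inter_subset_left)

end CellFiltration

/-- The increments of `(M k / M 0) ^ s`, started at `1`. -/
noncomputable def powIncr (M : ℕ → ℝ) (s : ℝ) : ℕ → ℝ
  | 0 => 1
  | i + 1 => (M (i + 1) / M 0) ^ s - (M i / M 0) ^ s

section PowIncr

variable {M : ℕ → ℝ} {s D : ℝ}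

lemma powIncr_nonneg (hM0 : 0 < M 0) (hM : Monotone M) (hs : 0 ≤ s) (i : ℕ) :
    0 ≤ powIncr M s i := by
  cases i with
  | zero => exact zero_le_one
  | succ i =>
    have h0 : 0 ≤ M i := hM0.le.trans (hM (Nat.zero_le i))
    exact sub_nonneg.2 (Real.rpow_le_rpow (div_nonneg h0 hM0.le)
      (div_le_div_of_nonneg_right (hM (Nat.le_succ i)) hM0.le) hs)

lemma sum_powIncr (hM0 : 0 < M 0) (N : ℕ) :
    ∑ i ∈ Finset.range (N + 1), powIncr M s i = (M N / M 0) ^ s := by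
  induction N with
  | zero => simp [powIncr, div_self hM0.ne']
  | succ N ih => rw [Finset.sum_range_succ, ih, powIncr]; ring

/-- A discrete form of `a ^ s = 1 + s ∫ log`, with controlled step ratio. -/
lemma rpow_le_one_add_sum_powIncr (hM0 : 0 < M 0) (hM : Monotone M) (hs : 0 ≤ s)
    (hMD : ∀ i, M (i + 1) ≤ D * M i) (hsD : s * Real.log D ≤ 1) (N : ℕ) :
    (M N / M 0) ^ s ≤ 1 + s * (1 + s * Real.log D) *
      ∑ i ∈ Finset.range N, powIncr M s i * Real.log (M N / M i) := by
  have hpos : ∀ i, 0 < M i := fun i => hM0.trans_le (hM (Nat.zero_le i))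
  induction N with
  | zero => simp [div_self hM0.ne']
  | succ N ih =>
    have hsum : ∑ i ∈ Finset.range (N + 1), powIncr M s i * Real.log (M (N + 1) / M i) =
        ∑ i ∈ Finset.range N, powIncr M s i * Real.log (M N / M i) +
          (M N / M 0) ^ s * Real.log (M (N + 1) / M N) := by
      rw [← sum_powIncr hM0 N, Finset.sum_mul]
      have : ∑ i ∈ Finset.range N, powIncr M s i * Real.log (M N / M i) =
          ∑ i ∈ Finset.range (N + 1), powIncr M s i * Real.log (M N / M i) := by
        rw [Finset.sum_range_succ, div_self (hpos N).ne']
        simp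
      rw [this, ← Finset.sum_add_distrib]
      refine Finset.sum_congr rfl fun i _ => ?_
      rw [← mul_add, ← Real.log_mul (div_pos (hpos N) (hpos i)).ne'
        (div_pos (hpos (N + 1)) (hpos N)).ne']
      congr 2
      have := (hpos N).ne'
      have := (hpos i).ne'
      field_simp
    have hρ : 1 ≤ M (N + 1) / M N := (one_le_div (hpos N)).2 (hM (Nat.le_succ N))
    have hρD : M (N + 1) / M N ≤ D := (div_le_iff₀ (hpos N)).2 (hMD N)
    have hρ0 : 0 < M (N + 1) / M N := zero_lt_one.trans_le hρ
    have hlog0 := Real.log_nonneg hρ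
    have hlogD := Real.log_le_log hρ0 hρD
    have hfac : (M (N + 1) / M 0) ^ s = (M N / M 0) ^ s * (M (N + 1) / M N) ^ s := by
      rw [← Real.mul_rpow (div_pos (hpos N) hM0).le hρ0.le]
      congr 1
      have := (hpos N).ne'
      field_simp
    set u := s * Real.log (M (N + 1) / M N) with hu
    have hu0 : 0 ≤ u := mul_nonneg hs hlog0
    have huD : u ≤ s * Real.log D := mul_le_mul_of_nonneg_left hlogD hs
    have hexp : (M (N + 1) / M N) ^ s ≤ 1 + u * (1 + s * Real.log D) := by
      rw [Real.rpow_def_of_pos hρ0, mul_comm, ← hu]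
      have h1 := Real.abs_exp_sub_one_sub_id_le (x := u) (by
        rw [abs_of_nonneg hu0]; exact huD.trans hsD)
      have h2 := (abs_le.1 h1).2
      nlinarith
    have ha : 0 ≤ (M N / M 0) ^ s := Real.rpow_nonneg (div_pos (hpos N) hM0).le s
    rw [hsum, hfac]
    calc (M N / M 0) ^ s * (M (N + 1) / M N) ^ s
        ≤ (M N / M 0) ^ s * (1 + u * (1 + s * Real.log D)) := by gcongr
      _ = (M N / M 0) ^ s + s * (1 + s * Real.log D) *
          ((M N / M 0) ^ s * Real.log (M (N + 1) / M N)) := by rw [hu]; ring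
      _ ≤ _ := by linarith

end PowIncr

namespace CellFiltration

variable {α ι : Type*} [MeasurableSpace α] {μ : Measure α} {W : α → ℝ≥0∞} {D : ℝ}
  {π : ℕ → α → ι} [Countable ι]

/-- A uniform logarithmic bound on all cells improves to a power bound. -/
lemma lintegral_rpow_runMax_le (F : CellFiltration μ W D π) (hW : Measurable W) (hD : 1 ≤ D)
    {s C : ℝ} (hs : 0 ≤ s) (hsD : s * Real.log D ≤ 1)
    (hsC : s * C * (1 + s * Real.log D) ≤ 1 / 2)
    (hlog : ∀ k m x, ∫⁻ y in cell π k x, W y * ENNReal.ofReal (Real.log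
        (runMax (fun j => cellAvg μ W π (k + j)) m y / cellAvg μ W π k y)) ∂μ ≤
      ENNReal.ofReal C * ∫⁻ y in cell π k x, W y ∂μ) (x : α) (N : ℕ) :
    ∫⁻ y in cell π 0 x, W y * ENNReal.ofReal
        ((runMax (cellAvg μ W π) N y / cellAvg μ W π 0 y) ^ s) ∂μ ≤
      2 * ∫⁻ y in cell π 0 x, W y ∂μ := by
  set X := cellAvg μ W π with hX
  let M : α → ℕ → ℝ := fun y i => runMax X i y
  have hM0 : ∀ y, 0 < M y 0 := fun y => F.runMax_pos 0 y
  have hMp : ∀ y i, 0 < M y i := fun y i => F.runMax_pos i y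
  have hMm : ∀ y, Monotone (M y) := fun y _ _ h => runMax_mono h y
  have hMD : ∀ y i, M y (i + 1) ≤ D * M y i := fun y i => F.runMax_succ_le hD i y
  have hlogD : 0 ≤ Real.log D := Real.log_nonneg hD
  have hMmeas : ∀ i, Measurable fun y => M y i := fun i => F.measurable_runMax i
  have hdn : ∀ i y, 0 ≤ powIncr (M y) s i := fun i y => powIncr_nonneg (hM0 y) (hMm y) hs i
  have hdmeas : ∀ i, Measurable fun y => powIncr (M y) s i := by
    intro i
    cases i with
    | zero => exact measurable_const
    | succ i =>
      exact (((hMmeas (i + 1)).div (hMmeas 0)).pow_const s).sub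
        (((hMmeas i).div (hMmeas 0)).pow_const s)
  have hlogn : ∀ {i} y, i ≤ N → 0 ≤ Real.log (M y N / M y i) := fun y h =>
    Real.log_nonneg ((one_le_div (hMp y _)).2 (hMm y h))
  -- the part of the sum coming from level `i`
  have hpiece : ∀ i ∈ Finset.range N, ∫⁻ y in cell π 0 x, W y * ENNReal.ofReal
        (powIncr (M y) s i * Real.log (M y N / M y i)) ∂μ ≤
      ∫⁻ y in cell π 0 x, ENNReal.ofReal C *
        (W y * ENNReal.ofReal (powIncr (M y) s i)) ∂μ := by
    intro i hi
    have hiN : i ≤ N := (Finset.mem_range.1 hi).le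
    refine F.lintegral_le_of_cells i (F.cell_saturated (Nat.zero_le _) x) fun z _ => ?_
    have hdc : ∀ y ∈ cell π i z, powIncr (M y) s i = powIncr (M z) s i := by
      intro y hy
      have hc : ∀ j ≤ i, M y j = M z j := fun j hj => F.runMax_congr_cell hj hy
      cases i with
      | zero => rfl
      | succ i =>
        simp only [powIncr, hc (i + 1) le_rfl, hc i (Nat.le_succ i),
          hc 0 (Nat.zero_le _)]
    have hr : ∫⁻ y in cell π i z, ENNReal.ofReal C *
          (W y * ENNReal.ofReal (powIncr (M y) s i)) ∂μ =
        ENNReal.ofReal C * (∫⁻ y in cell π i z, W y ∂μ) *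
          ENNReal.ofReal (powIncr (M z) s i) := by
      rw [mul_assoc, ← lintegral_mul_const' _ _ ENNReal.ofReal_ne_top,
        ← lintegral_const_mul' _ _ ENNReal.ofReal_ne_top]
      exact setLIntegral_congr_fun (F.measurableSet_cell _ z)
        fun y hy => by simp only [hdc y hy]
    by_cases hd : powIncr (M z) s i = 0
    · rw [setLIntegral_congr_fun (g := fun _ => 0) (F.measurableSet_cell _ z)
        fun y hy => by simp only [hdc y hy, hd, zero_mul, ENNReal.ofReal_zero, mul_zero]]
      simp
    · have hrec : M z i = X i z := by
        cases i with
        | zero => rfl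
        | succ i =>
          by_contra hne
          have hle : X (i + 1) z ≤ M z i := by
            by_contra hlt
            exact hne (max_eq_right (not_le.1 hlt).le)
          have : M z (i + 1) = M z i := max_eq_left hle
          exact hd (by simp [powIncr, this])
      have hl : ∫⁻ y in cell π i z, W y * ENNReal.ofReal
            (powIncr (M y) s i * Real.log (M y N / M y i)) ∂μ =
          (∫⁻ y in cell π i z, W y * ENNReal.ofReal (Real.log
            (runMax (fun j => X (i + j)) (N - i) y / X i y)) ∂μ) *
          ENNReal.ofReal (powIncr (M z) s i) := by
        rw [← lintegral_mul_const' _ _ ENNReal.ofReal_ne_top]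
        refine setLIntegral_congr_fun (F.measurableSet_cell _ z) fun y hy => ?_
        have h1 : M y i = X i y := by
          have e1 : M y i = M z i := F.runMax_congr_cell le_rfl hy
          have e2 : X i y = X i z := F.cellAvg_congr le_rfl hy
          rw [e1, e2, hrec]
        have h2 : M y N = runMax (fun j => X (i + j)) (N - i) y := by
          have h3 : M y N = max (M y i) (runMax (fun j => X (i + j)) (N - i) y) := by
            have := runMax_add (X := X) i (N - i) y
            rwa [Nat.add_sub_cancel' hiN] at this
          rw [h3, h1]
          exact max_eq_right (le_runMax (X := fun j => X (i + j)) (Nat.zero_le _) y)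
        simp only [hdc y hy, h1, ← h2]
        rw [ENNReal.ofReal_mul (hdn i z)]
        ring
      rw [hl, hr]
      exact mul_le_mul_left (hlog i (N - i) z) _
  have hI : ∫⁻ y in cell π 0 x, W y * ENNReal.ofReal ((M y N / M y 0) ^ s) ∂μ ≤
      ∫⁻ y in cell π 0 x, W y ∂μ + 2⁻¹ *
        ∫⁻ y in cell π 0 x, W y * ENNReal.ofReal ((M y N / M y 0) ^ s) ∂μ := by
    have hA0 : 0 ≤ s * (1 + s * Real.log D) := by positivity
    calc ∫⁻ y in cell π 0 x, W y * ENNReal.ofReal ((M y N / M y 0) ^ s) ∂μ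
        ≤ ∫⁻ y in cell π 0 x, (W y + ENNReal.ofReal (s * (1 + s * Real.log D)) *
          ∑ i ∈ Finset.range N, W y * ENNReal.ofReal
            (powIncr (M y) s i * Real.log (M y N / M y i))) ∂μ := by
          refine lintegral_mono fun y => ?_
          have h := rpow_le_one_add_sum_powIncr (hM0 y) (hMm y) hs (hMD y) hsD N
          have hn : ∀ i ∈ Finset.range N, 0 ≤ powIncr (M y) s i * Real.log (M y N / M y i) :=
            fun i hi => mul_nonneg (hdn i y) (hlogn y (Finset.mem_range.1 hi).le)
          calc W y * ENNReal.ofReal ((M y N / M y 0) ^ s)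
              ≤ W y * ENNReal.ofReal (1 + s * (1 + s * Real.log D) *
                ∑ i ∈ Finset.range N, powIncr (M y) s i * Real.log (M y N / M y i)) := by
                gcongr
            _ = _ := by
                rw [ENNReal.ofReal_add zero_le_one (mul_nonneg hA0 (Finset.sum_nonneg hn)),
                  ENNReal.ofReal_mul hA0, ENNReal.ofReal_sum_of_nonneg hn, ENNReal.ofReal_one,
                  mul_add, mul_one, ← Finset.mul_sum]
                ring
      _ = ∫⁻ y in cell π 0 x, W y ∂μ + ENNReal.ofReal (s * (1 + s * Real.log D)) *
          ∑ i ∈ Finset.range N, ∫⁻ y in cell π 0 x, W y * ENNReal.ofReal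
            (powIncr (M y) s i * Real.log (M y N / M y i)) ∂μ := by
          rw [lintegral_add_left hW, lintegral_const_mul' _ _ ENNReal.ofReal_ne_top,
            lintegral_finsetSum]
          exact fun i _ => hW.mul ((hdmeas i).mul
            ((hMmeas N).div (hMmeas i)).log).ennreal_ofReal
      _ ≤ ∫⁻ y in cell π 0 x, W y ∂μ + ENNReal.ofReal (s * (1 + s * Real.log D)) *
          ∑ i ∈ Finset.range N, ∫⁻ y in cell π 0 x, ENNReal.ofReal C *
            (W y * ENNReal.ofReal (powIncr (M y) s i)) ∂μ := by
          exact add_le_add_right (mul_le_mul_right (Finset.sum_le_sum hpiece) _) _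
      _ = ∫⁻ y in cell π 0 x, W y ∂μ + ENNReal.ofReal (s * C * (1 + s * Real.log D)) *
          ∫⁻ y in cell π 0 x, ∑ i ∈ Finset.range N,
            W y * ENNReal.ofReal (powIncr (M y) s i) ∂μ := by
          have hm : ∀ i ∈ Finset.range N,
              Measurable fun y => W y * ENNReal.ofReal (powIncr (M y) s i) :=
            fun i _ => hW.mul (hdmeas i).ennreal_ofReal
          rw [lintegral_finsetSum _ hm]
          simp only [lintegral_const_mul' _ _ ENNReal.ofReal_ne_top]
          rw [← Finset.mul_sum, ← mul_assoc, ← ENNReal.ofReal_mul hA0]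
          congr 3
          ring
      _ ≤ _ := by
          have h2 : ENNReal.ofReal (s * C * (1 + s * Real.log D)) ≤ 2⁻¹ := by
            refine (ENNReal.ofReal_le_ofReal hsC).trans ?_
            rw [one_div, ENNReal.ofReal_inv_of_pos two_pos, ENNReal.ofReal_ofNat]
          gcongr with y
          rw [← Finset.mul_sum, ← ENNReal.ofReal_sum_of_nonneg fun i _ => hdn i y,
            ← sum_powIncr (hM0 y) N, Finset.sum_range_succ]
          gcongr
          exact le_add_of_nonneg_right (hdn N y)
  have hfin : ∫⁻ y in cell π 0 x, W y * ENNReal.ofReal ((M y N / M y 0) ^ s) ∂μ ≠ ∞ := by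
    refine ne_top_of_le_ne_top (ENNReal.mul_ne_top (F.mass_ne_top 0 x)
      (ENNReal.ofReal_ne_top (r := (D ^ N) ^ s))) ?_
    rw [← lintegral_mul_const' _ _ ENNReal.ofReal_ne_top]
    refine lintegral_mono fun y => ?_
    gcongr
    · exact div_nonneg (hMp y N).le (hM0 y).le
    · exact (div_le_iff₀ (hM0 y)).2 (F.runMax_le_pow hD N y)
  change ∫⁻ y in cell π 0 x, W y * ENNReal.ofReal ((M y N / M y 0) ^ s) ∂μ ≤ _
  set I := ∫⁻ y in cell π 0 x, W y * ENNReal.ofReal ((M y N / M y 0) ^ s) ∂μ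
  have hhalf : I = 2⁻¹ * I + 2⁻¹ * I := by
    rw [← add_mul, ENNReal.inv_two_add_inv_two, one_mul]
  have hle : 2⁻¹ * I ≤ ∫⁻ y in cell π 0 x, W y ∂μ := by
    have hf : 2⁻¹ * I ≠ ∞ := ENNReal.mul_ne_top (by simp) hfin
    refine (ENNReal.add_le_add_iff_right hf).1 ?_
    rw [← hhalf]
    exact hI
  calc I = 2 * (2⁻¹ * I) := by
        rw [← mul_assoc, ENNReal.mul_inv_cancel two_ne_zero ENNReal.ofNat_ne_top, one_mul]
    _ ≤ _ := by gcongr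

end CellFiltration

lemma log_le_log_mul_card {Λ q : ℝ} (hΛ : 1 < Λ) (m : ℕ) (hq1 : 1 ≤ q) (hq : q ≤ Λ ^ m) :
    Real.log q ≤ Real.log Λ * ∑ i ∈ Finset.range m, (if Λ ^ i ≤ q then 1 else 0) := by
  have hl := Real.log_pos hΛ
  induction m with
  | zero => simpa using Real.log_nonpos (by linarith) (by simpa using hq)
  | succ m ih =>
    rcases le_or_gt q (Λ ^ m) with h | h
    · refine (ih h).trans ?_
      rw [Finset.sum_range_succ]
      refine mul_le_mul_of_nonneg_left (le_add_of_nonneg_right ?_) hl.le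
      split_ifs <;> norm_num
    · rw [Finset.sum_congr rfl (g := fun _ => (1 : ℝ)) fun i hi => if_pos
        ((pow_le_pow_right₀ hΛ.le (Nat.lt_succ_iff.1 (Finset.mem_range.1 hi))).trans h.le)]
      have := Real.log_le_log (by linarith) hq
      rw [Real.log_pow] at this
      simp only [Finset.sum_const, Finset.card_range, nsmul_eq_mul, mul_one]
      linarith

namespace CellFiltration

variable {α ι : Type*} [MeasurableSpace α] {μ : Measure α} {W : α → ℝ≥0∞} {D : ℝ}
  {π : ℕ → α → ι} [Countable ι]

/-- If `f` has a fixed fraction of the mass of `W` on every cell, even after removing a small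
part of the cell, then the integral of `f` controls the entropy of `W`. -/
lemma lintegral_log_runMax_le_of_robust (F : CellFiltration μ W D π) (hW : Measurable W)
    (hD : 1 ≤ D) {Λ c : ℝ} (hΛ : 1 < Λ) {f : α → ℝ≥0∞} (x : α)
    (hf : ∀ k, ∀ z ∈ cell π 0 x, ∀ B, MeasurableSet B → B ⊆ cell π k z →
      ENNReal.ofReal Λ * μ B ≤ μ (cell π k z) →
      ENNReal.ofReal c * ∫⁻ y in cell π k z, W y ∂μ ≤ ∫⁻ y in cell π k z \ B, f y ∂μ) (N : ℕ) :
    ENNReal.ofReal c * ∫⁻ y in cell π 0 x, W y * ENNReal.ofReal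
        (Real.log (runMax (cellAvg μ W π) N y / cellAvg μ W π 0 y)) ∂μ ≤
      ENNReal.ofReal (Real.log (D * Λ)) * ∫⁻ y in cell π 0 x, f y ∂μ := by
  set X := cellAvg μ W π with hX
  set R := cell π 0 x with hR
  have hDΛ : 1 < D * Λ := by nlinarith
  have hX0 : 0 < X 0 x := F.cellAvg_pos 0 x
  let t : ℕ → ℝ := fun i => (D * Λ) ^ i * X 0 x
  have ht0 : ∀ i, 0 < t i := fun i => by positivity
  have htX : ∀ i, X 0 x ≤ t i := fun i => le_mul_of_one_le_left hX0.le (one_le_pow₀ hDΛ.le)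
  have hts : ∀ i, t (i + 1) = D * Λ * t i := fun i => by simp only [t]; ring
  let E : ℕ → Set α := fun i => {y | t i ≤ runMax X N y}
  have hEm : ∀ i, MeasurableSet (E i) := fun i =>
    measurableSet_le measurable_const (F.measurable_runMax N)
  have hRm : MeasurableSet R := F.measurableSet_cell 0 x
  -- the estimate on a cell whose average is comparable to `t i`
  have hcell : ∀ i, ∀ k ≤ N, ∀ z ∈ R, t i ≤ X k z → runMax X k z ≤ D * t i →
      ∫⁻ y in cell π k z, ENNReal.ofReal c * W y ∂μ ≤
        ∫⁻ y in cell π k z, (E (i + 1))ᶜ.indicator f y ∂μ := by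
    intro i k hk z hz hzt hzM
    rw [lintegral_const_mul _ hW, setLIntegral_indicator (hEm _).compl, Set.inter_comm,
      ← Set.sdiff_eq, ← Set.sdiff_inter_self_eq_sdiff, Set.inter_comm]
    refine hf k z hz _ ((F.measurableSet_cell k z).inter (hEm _)) Set.inter_subset_left ?_
    have hsub : cell π k z ∩ E (i + 1) ⊆ cell (fun j => π (k + j)) 0 z ∩
        {y | t (i + 1) ≤ runMax (cellAvg μ W fun j => π (k + j)) (N - k) y} := by
      rintro y ⟨hy, hyE⟩
      refine ⟨hy, ?_⟩
      have h1 : runMax X N y = max (runMax X k y) (runMax (fun j => X (k + j)) (N - k) y) := by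
        have := runMax_add (X := X) k (N - k) y
        rwa [Nat.add_sub_cancel' hk] at this
      have h2 : runMax X k y = runMax X k z := F.runMax_congr_cell le_rfl hy
      have h3 : runMax X k y < t (i + 1) := by
        rw [h2, hts]
        refine hzM.trans_lt ?_
        have := ht0 i
        nlinarith [mul_pos (by linarith : 0 < D) this]
      have hyE' : t (i + 1) ≤ runMax X N y := hyE
      rw [h1, le_max_iff] at hyE'
      exact hyE'.resolve_left (not_le.2 h3)
    have hweak := (mul_le_mul_right (measure_mono hsub) _).trans
      ((F.shift k).ofReal_mul_measure_le z (t (i + 1)) (N - k))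
    have hm : ∫⁻ y in cell (fun j => π (k + j)) 0 z, W y ∂μ ≤
        ENNReal.ofReal (D * t i) * μ (cell π k z) := by
      have := F.ofReal_cellAvg_mul k z
      change ∫⁻ y in cell π k z, W y ∂μ ≤ _
      rw [← this]
      gcongr
      exact (le_runMax (X := X) le_rfl z).trans hzM
    have hDt : 0 < D * t i := mul_pos (by linarith) (ht0 i)
    have h := hweak.trans hm
    rw [hts, show D * Λ * t i = D * t i * Λ by ring, ENNReal.ofReal_mul hDt.le, mul_assoc] at h
    exact (ENNReal.mul_le_mul_iff_right (ENNReal.ofReal_pos.2 hDt).ne' ENNReal.ofReal_ne_top).1 h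
  have hlevel : ∀ i, ∀ j ≤ N, ∫⁻ y in R ∩ {y | t i ≤ runMax X j y}, ENNReal.ofReal c * W y ∂μ ≤
      ∫⁻ y in R ∩ {y | t i ≤ runMax X j y}, (E (i + 1))ᶜ.indicator f y ∂μ := by
    intro i j
    induction j with
    | zero =>
      intro _
      refine F.lintegral_le_of_cells 0 ?_ ?_
      · rintro z ⟨hz, hz'⟩ y hy
        exact ⟨F.cell_saturated le_rfl x z hz hy,
          hz'.trans (F.runMax_congr_cell le_rfl hy).ge⟩
      · rintro z ⟨hz, hz'⟩
        refine hcell i 0 (Nat.zero_le _) z hz hz' ?_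
        have h1 : X 0 z = X 0 x := F.cellAvg_congr le_rfl hz
        change X 0 z ≤ _
        rw [h1]
        exact (htX i).trans (le_mul_of_one_le_left (ht0 i).le hD)
    | succ j ih =>
      intro hj
      have hU : R ∩ {y | t i ≤ runMax X (j + 1) y} =
          (R ∩ {y | t i ≤ runMax X j y}) ∪
          (R ∩ {y | runMax X j y < t i ∧ t i ≤ X (j + 1) y}) := by
        ext y
        simp only [Set.mem_inter_iff, Set.mem_ofPred_eq, Set.mem_union, runMax, le_max_iff]
        by_cases h : t i ≤ runMax X j y
        · simp [h]
        · simp [h, not_le.1 h]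
      have hsat : ∀ z ∈ R ∩ {y | runMax X j y < t i ∧ t i ≤ X (j + 1) y},
          cell π (j + 1) z ⊆ R ∩ {y | runMax X j y < t i ∧ t i ≤ X (j + 1) y} := by
        rintro z ⟨hz, hz1, hz2⟩ y hy
        refine ⟨F.cell_saturated (Nat.zero_le _) x z hz hy, ?_, ?_⟩
        · rwa [F.runMax_congr_cell (Nat.le_succ j) hy]
        · rwa [hX, F.cellAvg_congr le_rfl hy]
      have hdisj : Disjoint (R ∩ {y | t i ≤ runMax X j y})
          (R ∩ {y | runMax X j y < t i ∧ t i ≤ X (j + 1) y}) :=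
        Set.disjoint_left.2 fun y h1 h2 => absurd h1.2 (not_le.2 h2.2.1)
      have hms := F.measurableSet_of_saturated (j + 1) hsat
      rw [hU, lintegral_union hms hdisj, lintegral_union hms hdisj]
      refine add_le_add (ih (by omega)) (F.lintegral_le_of_cells (j + 1) hsat ?_)
      rintro z ⟨hz, hz1, hz2⟩
      refine hcell i (j + 1) hj z hz hz2 ?_
      exact (F.runMax_succ_le hD j z).trans
        (mul_le_mul_of_nonneg_left hz1.le (by linarith))
  have hlogΛ : 0 ≤ Real.log (D * Λ) := Real.log_nonneg hDΛ.le
  calc ENNReal.ofReal c * ∫⁻ y in R, W y * ENNReal.ofReal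
        (Real.log (runMax X N y / X 0 y)) ∂μ
      ≤ ENNReal.ofReal c * ∫⁻ y in R, ENNReal.ofReal (Real.log (D * Λ)) *
        ∑ i ∈ Finset.range N, (E i).indicator W y ∂μ := by
        refine mul_le_mul_right (setLIntegral_mono' hRm fun y hy => ?_) _
        have h1 : X 0 y = X 0 x := F.cellAvg_congr le_rfl hy
        have hq1 : 1 ≤ runMax X N y / X 0 y :=
          (one_le_div (F.cellAvg_pos 0 y)).2 (le_runMax (Nat.zero_le N) y)
        have hq2 : runMax X N y / X 0 y ≤ (D * Λ) ^ N := by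
          refine ((div_le_iff₀ (F.cellAvg_pos 0 y)).2 (F.runMax_le_pow hD N y)).trans ?_
          exact pow_le_pow_left₀ (by linarith) (le_mul_of_one_le_right (by linarith) hΛ.le) N
        have hlog := log_le_log_mul_card hDΛ N hq1 hq2
        calc W y * ENNReal.ofReal (Real.log (runMax X N y / X 0 y))
            ≤ W y * ENNReal.ofReal (Real.log (D * Λ) * ∑ i ∈ Finset.range N,
              (if (D * Λ) ^ i ≤ runMax X N y / X 0 y then 1 else 0)) := by gcongr
          _ = _ := by
              rw [ENNReal.ofReal_mul hlogΛ, ENNReal.ofReal_sum_of_nonneg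
                (fun i _ => by split_ifs <;> norm_num), mul_left_comm, Finset.mul_sum]
              congr 1
              refine Finset.sum_congr rfl fun i _ => ?_
              have hiff : (D * Λ) ^ i ≤ runMax X N y / X 0 y ↔ y ∈ E i := by
                rw [le_div_iff₀ (F.cellAvg_pos 0 y), ← hX, h1]
                rfl
              by_cases hi : y ∈ E i
              · simp [hiff, hi]
              · simp [hiff, hi]
    _ = ENNReal.ofReal (Real.log (D * Λ)) *
        ∑ i ∈ Finset.range N, ∫⁻ y in R ∩ E i, ENNReal.ofReal c * W y ∂μ := by
        rw [lintegral_const_mul' _ _ ENNReal.ofReal_ne_top,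
          lintegral_finsetSum _ fun i _ => hW.indicator (hEm i), mul_left_comm, Finset.mul_sum]
        congr 1
        refine Finset.sum_congr rfl fun i _ => ?_
        rw [lintegral_const_mul _ hW, setLIntegral_indicator (hEm i), Set.inter_comm]
    _ ≤ ENNReal.ofReal (Real.log (D * Λ)) *
        ∑ i ∈ Finset.range N, ∫⁻ y in R ∩ E i, (E (i + 1))ᶜ.indicator f y ∂μ :=
        mul_le_mul_right (Finset.sum_le_sum fun i _ => hlevel i N le_rfl) _
    _ = ENNReal.ofReal (Real.log (D * Λ)) *
        ∫⁻ y in ⋃ i ∈ Finset.range N, (E (i + 1))ᶜ ∩ (R ∩ E i), f y ∂μ := by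
        rw [lintegral_biUnion_finset]
        · congr 1
          refine Finset.sum_congr rfl fun i _ => ?_
          rw [setLIntegral_indicator (hEm _).compl]
        · have hlt : ∀ i j, i < j → Disjoint ((E (i + 1))ᶜ ∩ (R ∩ E i))
              ((E (j + 1))ᶜ ∩ (R ∩ E j)) := by
            intro i j hij
            refine Set.disjoint_left.2 fun y h1 h2 => h1.1 ?_
            have h3 : t j ≤ runMax X N y := h2.2.2
            refine le_trans ?_ h3
            exact mul_le_mul_of_nonneg_right (pow_le_pow_right₀ hDΛ.le hij) hX0.le
          intro i _ j _ hij
          rcases lt_or_gt_of_ne hij with h | h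
          · exact hlt i j h
          · exact (hlt j i h).symm
        · exact fun i _ => (hEm _).compl.inter (hRm.inter (hEm _))
    _ ≤ _ := by
        refine mul_le_mul_right (lintegral_mono_set ?_) _
        exact Set.iUnion₂_subset fun i _ y hy => hy.2.1

end CellFiltration

section DyadicBoxes

variable {n : ℕ}

/-- The half-open box with lower corner `b` and side lengths `σ`. -/
def box (b σ : Fin n → ℝ) : Set (Fin n → ℝ) :=
  Set.univ.pi fun i => Set.Ico (b i) (b i + σ i)

lemma measurableSet_box (b σ : Fin n → ℝ) : MeasurableSet (box b σ) :=
  MeasurableSet.univ_pi fun _ => measurableSet_Ico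

lemma volume_box (b σ : Fin n → ℝ) : volume (box b σ) = ∏ i, ENNReal.ofReal (σ i) := by
  rw [box, Real.volume_pi_Ico]
  simp

lemma box_subset_Icc (b σ : Fin n → ℝ) : box b σ ⊆ Set.Icc b fun i => b i + σ i :=
  fun _ hx => ⟨fun i => (hx i trivial).1, fun i => (hx i trivial).2.le⟩

lemma box_ae_eq_Icc (b σ : Fin n → ℝ) :
    box b σ =ᵐ[volume] Set.Icc b fun i => b i + σ i :=
  Measure.univ_pi_Ico_ae_eq_Icc

/-- The index of the dyadic box containing `x` at level `k`, where the side of the root cube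
with corner `a` and side `l` has been halved `e k i` times in direction `i`. -/
noncomputable def dyadicIdx (a : Fin n → ℝ) (l : ℝ) (e : ℕ → Fin n → ℕ) (k : ℕ)
    (x : Fin n → ℝ) : Fin n → ℤ :=
  fun i => ⌊(x i - a i) / (l / 2 ^ e k i)⌋

section Dyadic

variable {a : Fin n → ℝ} {l : ℝ} {e : ℕ → Fin n → ℕ}

lemma cell_dyadicIdx (hl : 0 < l) (k : ℕ) (x : Fin n → ℝ) :
    cell (dyadicIdx a l e) k x =
      box (fun i => a i + dyadicIdx a l e k x i * (l / 2 ^ e k i)) fun i => l / 2 ^ e k i := by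
  ext y
  have hσ : ∀ i, 0 < l / 2 ^ e k i := fun i => by positivity
  simp only [box, Set.mem_univ_pi, Set.mem_Ico]
  constructor
  · intro h i
    have h' : ⌊(y i - a i) / (l / 2 ^ e k i)⌋ = dyadicIdx a l e k x i := congrFun h i
    rw [Int.floor_eq_iff, le_div_iff₀ (hσ i), div_lt_iff₀ (hσ i)] at h'
    constructor <;> linarith [h'.1, h'.2]
  · intro h
    funext i
    change ⌊(y i - a i) / (l / 2 ^ e k i)⌋ = dyadicIdx a l e k x i
    rw [Int.floor_eq_iff, le_div_iff₀ (hσ i), div_lt_iff₀ (hσ i)]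
    constructor <;> linarith [(h i).1, (h i).2]

lemma volume_cell_dyadicIdx (hl : 0 < l) (k : ℕ) (x : Fin n → ℝ) :
    volume (cell (dyadicIdx a l e) k x) = ENNReal.ofReal (l ^ n / 2 ^ ∑ i, e k i) := by
  rw [cell_dyadicIdx hl, volume_box, ← ENNReal.ofReal_prod_of_nonneg
    (fun i _ => by positivity), Finset.prod_div_distrib, Finset.prod_const,
    Finset.prod_pow_eq_pow_sum]
  simp

lemma cell_dyadicIdx_zero (hl : 0 < l) (he : ∀ i, e 0 i = 0) {x : Fin n → ℝ}
    (hx : x ∈ box a fun _ => l) : cell (dyadicIdx a l e) 0 x = box a fun _ => l := by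
  have h0 : ∀ i, dyadicIdx a l e 0 x i = 0 := by
    intro i
    have := hx i trivial
    simp only [dyadicIdx, he, pow_zero, div_one]
    rw [Int.floor_eq_iff, le_div_iff₀ hl, div_lt_iff₀ hl]
    constructor <;> push_cast <;> linarith [this.1, this.2]
  rw [cell_dyadicIdx hl]
  simp [h0, he]

lemma corner_mem_box (hl : 0 < l) : a ∈ box a fun _ => l :=
  fun i _ => ⟨le_rfl, by linarith⟩

/-- The partitions into dyadic boxes form a filtration. -/
lemma cellFiltration_dyadicIdx {w : (Fin n → ℝ) → ℝ} (hw : Measurable w)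
    (hpos : ∀ᵐ x, 0 < w x) (hloc : LocallyIntegrable w) (hl : 0 < l)
    (hmono : ∀ k i, e k i ≤ e (k + 1) i) {d : ℕ} (hd : ∀ k, ∑ i, e (k + 1) i = ∑ i, e k i + d) :
    CellFiltration volume (fun x => ENNReal.ofReal (w x)) (2 ^ d) (dyadicIdx a l e) where
  meas k j := by
    have hm : Measurable (dyadicIdx a l e k) := by
      refine measurable_pi_lambda _ fun i => ?_
      exact Int.measurable_floor.comp (((measurable_pi_apply i).sub_const _).div_const _)
    exact hm (measurableSet_singleton j)
  refines k x y h := by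
    funext i
    have hi : ⌊(x i - a i) / (l / 2 ^ e (k + 1) i)⌋ = ⌊(y i - a i) / (l / 2 ^ e (k + 1) i)⌋ :=
      congrFun h i
    obtain ⟨m, hm⟩ := Nat.exists_eq_add_of_le (hmono k i)
    have key : ∀ t : ℝ, ⌊t / (l / 2 ^ e k i)⌋ = ⌊t / (l / 2 ^ e (k + 1) i)⌋ / ((2 ^ m : ℕ) : ℤ) := by
      intro t
      rw [← Int.floor_div_natCast]
      congr 1
      rw [hm, pow_add]
      push_cast
      field_simp
    change ⌊(x i - a i) / (l / 2 ^ e k i)⌋ = ⌊(y i - a i) / (l / 2 ^ e k i)⌋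
    rw [key, key, hi]
  vol_ne_zero k x := by
    rw [volume_cell_dyadicIdx hl]
    exact (ENNReal.ofReal_pos.2 (by positivity)).ne'
  vol_ne_top k x := by
    rw [volume_cell_dyadicIdx hl]
    exact ENNReal.ofReal_ne_top
  mass_ne_zero k x := by
    have hv : volume (cell (dyadicIdx a l e) k x) ≠ 0 := by
      rw [volume_cell_dyadicIdx hl]
      exact (ENNReal.ofReal_pos.2 (by positivity)).ne'
    intro h
    rw [lintegral_eq_zero_iff hw.ennreal_ofReal] at h
    apply hv
    have h2 : ∀ᵐ y ∂(volume.restrict (cell (dyadicIdx a l e) k x)), False := by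
      filter_upwards [h, ae_restrict_of_ae hpos] with y h1 h2
      exact absurd (ENNReal.ofReal_eq_zero.1 h1) (not_le.2 h2)
    simpa using h2
  mass_ne_top k x := by
    rw [cell_dyadicIdx hl]
    refine ne_top_of_le_ne_top ?_ (lintegral_mono_set (box_subset_Icc _ _))
    exact (hloc.integrableOn_isCompact isCompact_Icc).lintegral_lt_top.ne
  vol_le k x := by
    rw [volume_cell_dyadicIdx hl, volume_cell_dyadicIdx hl, ← ENNReal.ofReal_mul (by positivity),
      hd, pow_add]
    refine ENNReal.ofReal_le_ofReal (le_of_eq ?_)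
    field_simp

end Dyadic

/-- The exponents of the partition into dyadic cubes. -/
def cubeExp (k : ℕ) (_ : Fin n) : ℕ := k

/-- The exponents of the partition obtained by halving one side at a time, cyclically. -/
def cyclicExp (k : ℕ) (i : Fin n) : ℕ := k / n + if (i : ℕ) < k % n then 1 else 0

lemma sum_cyclicExp (hn : 0 < n) (k : ℕ) : ∑ i : Fin n, cyclicExp k i = k := by
  have hlt := Nat.mod_lt k hn
  have h : ∑ i : Fin n, (if (i : ℕ) < k % n then 1 else 0) = k % n := by
    rw [Fin.sum_univ_eq_sum_range (fun i => if i < k % n then 1 else 0) n, ← Finset.sum_filter]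
    simp only [Finset.sum_const, smul_eq_mul, mul_one]
    rw [show (Finset.range n).filter (· < k % n) = Finset.range (k % n) by
      ext i; simp; omega, Finset.card_range]
  simp only [cyclicExp, Finset.sum_add_distrib, h, Finset.sum_const, Finset.card_univ,
    Fintype.card_fin, smul_eq_mul]
  exact Nat.div_add_mod k n

lemma cyclicExp_mono (k : ℕ) (i : Fin n) : cyclicExp k i ≤ cyclicExp (k + 1) i := by
  have hn : 0 < n := i.pos
  have hi := i.isLt
  unfold cyclicExp
  have h1 := Nat.div_add_mod k n
  have h2 := Nat.div_add_mod (k + 1) n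
  have hl1 := Nat.mod_lt k hn
  rw [Nat.add_div hn, Nat.add_mod]
  rcases Nat.lt_or_ge 1 n with h | h
  · rw [Nat.div_eq_of_lt h, Nat.mod_eq_of_lt h]
    split_ifs <;> first | omega | skip
    rename_i h5 h6 h7
    rw [Nat.mod_eq_of_lt (by omega)] at h7
    omega
  · obtain rfl : n = 1 := by omega
    simp [Nat.mod_one]

lemma cyclicExp_mul (hn : 0 < n) (q : ℕ) (i : Fin n) : cyclicExp (q * n) i = q := by
  simp [cyclicExp, Nat.mul_div_cancel q hn]

section Cubes

variable {w : (Fin n → ℝ) → ℝ} {a : Fin n → ℝ} {l : ℝ}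

lemma cellFiltration_cube (hw : Measurable w) (hpos : ∀ᵐ x, 0 < w x)
    (hloc : LocallyIntegrable w) (hl : 0 < l) :
    CellFiltration volume (fun x => ENNReal.ofReal (w x)) (2 ^ n) (dyadicIdx a l cubeExp) :=
  cellFiltration_dyadicIdx hw hpos hloc hl (fun k _ => Nat.le_succ k)
    fun k => by simp [mul_add]

lemma cellFiltration_cyclic (hn : 0 < n) (hw : Measurable w) (hpos : ∀ᵐ x, 0 < w x)
    (hloc : LocallyIntegrable w) (hl : 0 < l) :
    CellFiltration volume (fun x => ENNReal.ofReal (w x)) 2 (dyadicIdx a l cyclicExp) := by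
  have := cellFiltration_dyadicIdx (a := a) hw hpos hloc hl (cyclicExp_mono (n := n)) (d := 1)
    fun k => by rw [sum_cyclicExp hn, sum_cyclicExp hn]
  simpa using this

lemma cell_cyclicExp_mul (hn : 0 < n) (q : ℕ) (x : Fin n → ℝ) :
    cell (dyadicIdx a l cyclicExp) (q * n) x = cell (dyadicIdx a l cubeExp) q x := by
  have : ∀ y, dyadicIdx a l cyclicExp (q * n) y = dyadicIdx a l cubeExp q y := fun y => by
    funext i
    simp only [dyadicIdx, cyclicExp_mul hn, cubeExp]
  simp only [cell, this]

/-- Dyadic subcubes of a dyadic cube are dyadic subcubes of the root cube. -/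
lemma cell_subcube (k m : ℕ) (p : Fin n → ℤ) (y : Fin n → ℝ) (hl : 0 < l) :
    cell (dyadicIdx (fun i => a i + p i * (l / 2 ^ k)) (l / 2 ^ k) cubeExp) m y =
      cell (dyadicIdx a l cubeExp) (k + m) y := by
  have : ∀ (z : Fin n → ℝ) i, dyadicIdx (fun i => a i + p i * (l / 2 ^ k)) (l / 2 ^ k) cubeExp m z i =
      dyadicIdx a l cubeExp (k + m) z i - p i * 2 ^ m := by
    intro z i
    simp only [dyadicIdx, cubeExp]
    rw [← Int.floor_sub_intCast]
    congr 1
    push_cast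
    rw [pow_add]
    field_simp
    ring
  ext z
  simp only [cell, Set.mem_ofPred_eq, funext_iff, this, sub_left_inj]

end Cubes

end DyadicBoxes

section MaximalLowerBound

variable {n : ℕ}

/-- The volume of the Euclidean unit ball in `ℝⁿ`. -/
noncomputable def ballConst (n : ℕ) : ℝ := √Real.pi ^ n / Real.Gamma (n / 2 + 1)

lemma ballConst_pos (n : ℕ) : 0 < ballConst n :=
  div_pos (pow_pos (Real.sqrt_pos.2 Real.pi_pos) n) (Real.Gamma_pos_of_pos (by positivity))

lemma mem_euclBall {c x : Fin n → ℝ} {r : ℝ} (hr : 0 < r) :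
    x ∈ euclBall c r ↔ ∑ i, (x i - c i) ^ 2 < r ^ 2 := by
  change √(∑ i, (x i - c i) ^ 2) < r ↔ _
  rw [Real.sqrt_lt' hr]

lemma euclBall_eq_preimage (c : Fin n → ℝ) (r : ℝ) :
    euclBall c r = WithLp.toLp 2 ⁻¹' Metric.ball (WithLp.toLp 2 c) r := by
  ext x
  simp [euclBall, euclNorm, EuclideanSpace.dist_eq, Real.dist_eq, sq_abs]

lemma measurableSet_euclBall (c : Fin n → ℝ) (r : ℝ) : MeasurableSet (euclBall c r) := by
  rw [euclBall_eq_preimage]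
  exact (PiLp.volume_preserving_toLp (Fin n)).measurable measurableSet_ball

lemma volume_euclBall (hn : 0 < n) (c : Fin n → ℝ) {r : ℝ} (hr : 0 < r) :
    volume (euclBall c r) = ENNReal.ofReal (r ^ n * ballConst n) := by
  have : Nonempty (Fin n) := Fin.pos_iff_nonempty.1 hn
  rw [euclBall_eq_preimage, (PiLp.volume_preserving_toLp (Fin n)).measure_preimage
    measurableSet_ball.nullMeasurableSet, EuclideanSpace.volume_ball, Fintype.card_fin,
    ENNReal.ofReal_mul (by positivity), ENNReal.ofReal_pow hr.le, ballConst]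

lemma volume_euclBall_ne_zero (hn : 0 < n) (c : Fin n → ℝ) {r : ℝ} (hr : 0 < r) :
    volume (euclBall c r) ≠ 0 := by
  have := ballConst_pos n
  rw [volume_euclBall hn c hr]
  exact (ENNReal.ofReal_pos.2 (by positivity)).ne'

lemma volume_euclBall_ne_top (hn : 0 < n) (c : Fin n → ℝ) {r : ℝ} (hr : 0 < r) :
    volume (euclBall c r) ≠ ∞ := by
  rw [volume_euclBall hn c hr]
  exact ENNReal.ofReal_ne_top

lemma le_HLMax {w : (Fin n → ℝ) → ℝ} {Q S : Set (Fin n → ℝ)} (hS : MeasurableSet S)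
    (hSQ : S ⊆ Q) {c x : Fin n → ℝ} {r : ℝ} (hr : 0 < r) (hx : x ∈ euclBall c r) :
    (volume (euclBall c r))⁻¹ * ∫⁻ y in euclBall c r ∩ S, ENNReal.ofReal (w y) ≤
      HLMax (Q.indicator w) x := by
  refine le_trans ?_ (le_iSup₂_of_le c r (le_iSup₂_of_le hr hx le_rfl))
  refine mul_le_mul_right ?_ _
  rw [Set.inter_comm, ← setLIntegral_indicator hS]
  refine lintegral_mono fun y => ?_
  by_cases hy : y ∈ S
  · rw [Set.indicator_of_mem hy, Set.indicator_of_mem (hSQ hy)]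
    exact ENNReal.ofReal_le_ofReal (le_abs_self _)
  · simp [hy]

/-- The Fujii–Wilson condition on half-open cubes. -/
lemma lintegral_HLMax_box_le {w : (Fin n → ℝ) → ℝ} {K : ℝ}
    (hFW : ∀ Q : Set (Fin n → ℝ), IsCube Q →
      ∫⁻ x in Q, HLMax (Q.indicator w) x ≤
        ENNReal.ofReal K * ∫⁻ x in Q, ENNReal.ofReal (w x)) (a : Fin n → ℝ) {l : ℝ} (hl : 0 < l) :
    ∫⁻ x in box a fun _ => l, HLMax ((Set.Icc a fun i => a i + l).indicator w) x ≤
      ENNReal.ofReal K * ∫⁻ x in box a fun _ => l, ENNReal.ofReal (w x) := by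
  have h := hFW _ ⟨a, l, hl, rfl⟩
  rwa [setLIntegral_congr (box_ae_eq_Icc a fun _ => l),
    setLIntegral_congr (box_ae_eq_Icc a fun _ => l)]

/-- The dyadic maximal function of `w` over every cube has logarithmic integral against `w`
bounded by `C`. -/
def EntropyBound (w : (Fin n → ℝ) → ℝ) (C : ℝ) : Prop :=
  ∀ (a : Fin n → ℝ) (l : ℝ), 0 < l → ∀ N : ℕ,
    ∫⁻ y in box a fun _ => l, ENNReal.ofReal (w y) * ENNReal.ofReal (Real.log
      (runMax (cellAvg volume (fun x => ENNReal.ofReal (w x)) (dyadicIdx a l cubeExp)) N y /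
        cellAvg volume (fun x => ENNReal.ofReal (w x)) (dyadicIdx a l cubeExp) 0 y)) ≤
    ENNReal.ofReal C * ∫⁻ y in box a fun _ => l, ENNReal.ofReal (w y)

lemma box_subset_euclBall {b σ : Fin n → ℝ} {r : ℝ} (hr : 0 < r)
    (h : ∑ i, (σ i / 2) ^ 2 < r ^ 2) : box b σ ⊆ euclBall (fun i => b i + σ i / 2) r := by
  intro x hx
  rw [mem_euclBall hr]
  refine lt_of_le_of_lt (Finset.sum_le_sum fun i _ => ?_) h
  have := hx i trivial
  exact sq_le_sq' (by linarith [this.1, this.2]) (by linarith [this.1, this.2])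

lemma sum_cyclicExp_sq (hn : 0 < n) (k : ℕ) (l : ℝ) :
    ∑ i : Fin n, (l / 2 ^ cyclicExp k i / 2) ^ 2 =
      (l / 2 ^ (k / n)) ^ 2 * ((n - 3 * (k % n : ℕ) / 4) / 4) := by
  have hlt := Nat.mod_lt k hn
  have hterm : ∀ i : Fin n, (l / 2 ^ cyclicExp k i / 2) ^ 2 =
      (l / 2 ^ (k / n)) ^ 2 / 4 - if (i : ℕ) < k % n then 3 / 16 * (l / 2 ^ (k / n)) ^ 2 else 0 := by
    intro i
    unfold cyclicExp
    split_ifs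
    · rw [pow_succ]
      field_simp
      ring
    · simp
      ring
  have h : ∑ i : Fin n, (if (i : ℕ) < k % n then 3 / 16 * (l / 2 ^ (k / n)) ^ 2 else 0) =
      (k % n : ℕ) * (3 / 16 * (l / 2 ^ (k / n)) ^ 2) := by
    rw [Fin.sum_univ_eq_sum_range
      (fun i => if i < k % n then 3 / 16 * (l / 2 ^ (k / n)) ^ 2 else 0) n, ← Finset.sum_filter,
      show (Finset.range n).filter (· < k % n) = Finset.range (k % n) by ext i; simp; omega]
    simp
  simp only [hterm, Finset.sum_sub_distrib, h, Finset.sum_const, Finset.card_univ,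
    Fintype.card_fin, nsmul_eq_mul]
  ring

/-- Averages over cyclically bisected boxes are controlled by the maximal function. -/
lemma cellAvg_cyclic_le_HLMax (hn : 0 < n) {w : (Fin n → ℝ) → ℝ} (hw : Measurable w)
    (hpos : ∀ᵐ x, 0 < w x) (hloc : LocallyIntegrable w) {β : ℝ} (hβ0 : 0 < β)
    (hβ : ∀ j < n, ballConst n ^ 2 * (1001 / 1000 * (n - 3 * (j : ℝ) / 4) / 4) ^ n ≤
      (β / 2 ^ j) ^ 2) {a : Fin n → ℝ} {l : ℝ} (hl : 0 < l) (k : ℕ) {x : Fin n → ℝ}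
    (hx : x ∈ box a fun _ => l) :
    ENNReal.ofReal (cellAvg volume (fun x => ENNReal.ofReal (w x)) (dyadicIdx a l cyclicExp) k x) ≤
      ENNReal.ofReal β * HLMax ((Set.Icc a fun i => a i + l).indicator w) x := by
  have F := cellFiltration_cyclic (a := a) hn hw hpos hloc hl
  set j := k % n with hj
  have hjn : j < n := Nat.mod_lt k hn
  have hjn' : (j : ℝ) < n := by exact_mod_cast hjn
  set κ : ℝ := 1001 / 1000 * (n - 3 * (j : ℝ) / 4) / 4 with hκ
  have hκ0 : 0 < κ := by rw [hκ]; have : (0 : ℝ) ≤ j := Nat.cast_nonneg j; linarith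
  set l' := l / 2 ^ (k / n) with hl'
  have hl'0 : 0 < l' := by positivity
  set S := cell (dyadicIdx a l cyclicExp) k x with hS
  have hcell := cell_dyadicIdx (a := a) (e := cyclicExp) hl k x
  set b : Fin n → ℝ := fun i => a i + dyadicIdx a l cyclicExp k x i * (l / 2 ^ cyclicExp k i)
  set σ : Fin n → ℝ := fun i => l / 2 ^ cyclicExp k i
  set c : Fin n → ℝ := fun i => b i + σ i / 2
  set r := l' * √κ with hr
  have hr0 : 0 < r := mul_pos hl'0 (Real.sqrt_pos.2 hκ0)
  have hsub : S ⊆ euclBall c r := by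
    rw [hS, hcell]
    refine box_subset_euclBall hr0 ?_
    rw [sum_cyclicExp_sq hn, hr, mul_pow, Real.sq_sqrt hκ0.le, ← hl', ← hj]
    refine mul_lt_mul_of_pos_left ?_ (by positivity)
    rw [hκ]
    have : (0 : ℝ) ≤ j := Nat.cast_nonneg j
    linarith
  have hSQ : S ⊆ Set.Icc a fun i => a i + l := by
    refine ((F.cell_subset (Nat.zero_le k) x).trans ?_).trans (box_subset_Icc a fun _ => l)
    rw [cell_dyadicIdx_zero hl (fun i => by simp [cyclicExp]) hx]
  have hmax := le_HLMax (w := w) (F.measurableSet_cell k x) hSQ hr0 (hsub (mem_cell_self k x))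
  rw [← hS, Set.inter_eq_right.2 hsub, ← F.ofReal_cellAvg_mul k x, ← hS] at hmax
  have hvS : volume S = ENNReal.ofReal (l' ^ n / 2 ^ j) := by
    rw [hS, volume_cell_dyadicIdx hl, sum_cyclicExp hn]
    congr 1
    rw [hl', div_pow, ← pow_mul, div_div, ← pow_add, hj]
    congr 2
    rw [mul_comm]
    exact (Nat.div_add_mod k n).symm
  have hvol : volume (euclBall c r) ≤ ENNReal.ofReal β * volume S := by
    rw [volume_euclBall hn c hr0, hvS, ← ENNReal.ofReal_mul hβ0.le]
    refine ENNReal.ofReal_le_ofReal ?_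
    have h1 : ballConst n * √κ ^ n ≤ β / 2 ^ j := by
      refine le_of_sq_le_sq ?_ (by positivity)
      rw [mul_pow, ← pow_mul, mul_comm n 2, pow_mul, Real.sq_sqrt hκ0.le]
      exact hβ j hjn
    calc r ^ n * ballConst n = l' ^ n * (ballConst n * √κ ^ n) := by rw [hr, mul_pow]; ring
      _ ≤ l' ^ n * (β / 2 ^ j) := by gcongr
      _ = _ := by ring
  set X := cellAvg volume (fun x => ENNReal.ofReal (w x)) (dyadicIdx a l cyclicExp) k x
  have hB0 := volume_euclBall_ne_zero hn c hr0
  have hBt := volume_euclBall_ne_top hn c hr0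
  calc ENNReal.ofReal X = (volume (euclBall c r))⁻¹ * (ENNReal.ofReal X * volume (euclBall c r)) := by
        rw [mul_comm (ENNReal.ofReal X), ← mul_assoc, ENNReal.inv_mul_cancel hB0 hBt, one_mul]
    _ ≤ (volume (euclBall c r))⁻¹ * (ENNReal.ofReal X * (ENNReal.ofReal β * volume S)) := by gcongr
    _ = ENNReal.ofReal β * ((volume (euclBall c r))⁻¹ * (ENNReal.ofReal X * volume S)) := by ring
    _ ≤ _ := by gcongr

lemma runMax_cube_le_cyclic (hn : 0 < n) (W : (Fin n → ℝ) → ℝ≥0∞) (a : Fin n → ℝ) (l : ℝ) (N : ℕ)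
    (y : Fin n → ℝ) : runMax (cellAvg volume W (dyadicIdx a l cubeExp)) N y ≤
      runMax (cellAvg volume W (dyadicIdx a l cyclicExp)) (N * n) y := by
  refine runMax_le fun j hj => ?_
  rw [cellAvg, ← cell_cyclicExp_mul hn]
  exact le_runMax (X := cellAvg volume W (dyadicIdx a l cyclicExp)) (Nat.mul_le_mul_right n hj) y

/-- The entropy bound obtained by circumscribing balls about bisected boxes. -/
lemma entropyBound_of_ballConst (hn : 0 < n) {w : (Fin n → ℝ) → ℝ} (hw : Measurable w)
    (hpos : ∀ᵐ x, 0 < w x) (hloc : LocallyIntegrable w) {K : ℝ} (hK : 1 ≤ K)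
    (hFW : ∀ Q : Set (Fin n → ℝ), IsCube Q →
      ∫⁻ x in Q, HLMax (Q.indicator w) x ≤
        ENNReal.ofReal K * ∫⁻ x in Q, ENNReal.ofReal (w x)) {β : ℝ} (hβ1 : 1 ≤ β)
    (hβ : ∀ j < n, ballConst n ^ 2 * (1001 / 1000 * (n - 3 * (j : ℝ) / 4) / 4) ^ n ≤
      (β / 2 ^ j) ^ 2) : EntropyBound w (2 * Real.log 2 * (β * K - 1)) := by
  intro a l hl N
  have F := cellFiltration_cyclic (a := a) hn hw hpos hloc hl
  have hcell := cell_dyadicIdx_zero (a := a) (e := cyclicExp) hl (fun i => by simp [cyclicExp])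
    (corner_mem_box hl)
  have hlog := F.lintegral_log_runMax_le hw.ennreal_ofReal a (N * n)
  have hfin := F.mass_ne_top 0 a
  rw [hcell] at hlog hfin
  set Y := cellAvg volume (fun x => ENNReal.ofReal (w x)) (dyadicIdx a l cyclicExp) with hY
  set m := ∫⁻ y in box a fun _ => l, ENNReal.ofReal (w y)
  have hl2 : 0 < 2 * Real.log 2 := mul_pos two_pos (Real.log_pos one_lt_two)
  have hM : ∫⁻ y in box a fun _ => l, ENNReal.ofReal (runMax Y (N * n) y) ≤
      ENNReal.ofReal (β * K) * m := by
    calc ∫⁻ y in box a fun _ => l, ENNReal.ofReal (runMax Y (N * n) y)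
        ≤ ∫⁻ y in box a fun _ => l, ENNReal.ofReal β *
          HLMax ((Set.Icc a fun i => a i + l).indicator w) y := by
          refine setLIntegral_mono' (measurableSet_box _ _) fun y hy => ?_
          have : ∃ k, runMax Y (N * n) y = Y k y := by
            generalize N * n = N'
            induction N' with
            | zero => exact ⟨0, rfl⟩
            | succ q ih =>
              obtain ⟨k, hk⟩ := ih
              rcases max_choice (runMax Y q y) (Y (q + 1) y) with h | h
              · exact ⟨k, h.trans hk⟩
              · exact ⟨q + 1, h⟩
          obtain ⟨k, hk⟩ := this
          rw [hk]
          exact cellAvg_cyclic_le_HLMax hn hw hpos hloc (by linarith) hβ hl k hy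
      _ ≤ ENNReal.ofReal β * (ENNReal.ofReal K * m) := by
          rw [lintegral_const_mul' _ _ ENNReal.ofReal_ne_top]
          gcongr
          exact lintegral_HLMax_box_le hFW a hl
      _ = _ := by rw [← mul_assoc, ENNReal.ofReal_mul (by linarith)]
  have hcomp : ∫⁻ y in box a fun _ => l, ENNReal.ofReal (w y) * ENNReal.ofReal (Real.log
      (runMax (cellAvg volume (fun x => ENNReal.ofReal (w x)) (dyadicIdx a l cubeExp)) N y /
        cellAvg volume (fun x => ENNReal.ofReal (w x)) (dyadicIdx a l cubeExp) 0 y)) ≤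
      ∫⁻ y in box a fun _ => l, ENNReal.ofReal (w y) *
        ENNReal.ofReal (Real.log (runMax Y (N * n) y / Y 0 y)) := by
    have G := cellFiltration_cube (a := a) hw hpos hloc hl
    refine lintegral_mono fun y => ?_
    have h0 : Y 0 y =
        cellAvg volume (fun x => ENNReal.ofReal (w x)) (dyadicIdx a l cubeExp) 0 y := by
      rw [hY, cellAvg, cellAvg, ← cell_cyclicExp_mul hn, zero_mul]
    rw [h0]
    gcongr
    · exact div_pos (G.runMax_pos _ _) (G.cellAvg_pos _ _)
    · exact (G.cellAvg_pos _ _).le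
    · exact runMax_cube_le_cyclic hn _ a l N y
  refine hcomp.trans ?_
  have h := hlog.trans (mul_le_mul_right hM _)
  have hβK : 0 ≤ β * K - 1 := by nlinarith
  rw [← mul_assoc, ← ENNReal.ofReal_mul hl2.le,
    show 2 * Real.log 2 * (β * K) = 2 * Real.log 2 + 2 * Real.log 2 * (β * K - 1) by ring,
    ENNReal.ofReal_add hl2.le (mul_nonneg hl2.le hβK), add_mul] at h
  exact (ENNReal.add_le_add_iff_left (ENNReal.mul_ne_top ENNReal.ofReal_ne_top hfin)).1 h

end MaximalLowerBound

lemma ballConst_add_two (n : ℕ) : ballConst (n + 2) = ballConst n * (2 * Real.pi / (n + 2)) := by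
  have hG : Real.Gamma (((n + 2 : ℕ) : ℝ) / 2 + 1) = (n / 2 + 1) * Real.Gamma (n / 2 + 1) := by
    rw [← Real.Gamma_add_one (by positivity)]
    congr 1
    push_cast
    ring
  have h0 : Real.Gamma (n / 2 + 1) ≠ 0 := (Real.Gamma_pos_of_pos (by positivity)).ne'
  rw [ballConst, ballConst, hG, pow_add, Real.sq_sqrt Real.pi_pos.le]
  field_simp

lemma ballConst_zero : ballConst 0 = 1 := by simp [ballConst]

lemma ballConst_one : ballConst 1 = 2 := by
  have h : Real.Gamma (((1 : ℕ) : ℝ) / 2 + 1) = 1 / 2 * √Real.pi := by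
    rw [Real.Gamma_add_one (by norm_num)]
    norm_num [Real.Gamma_one_half_eq]
  have hp : √Real.pi ≠ 0 := (Real.sqrt_pos.2 Real.pi_pos).ne'
  rw [ballConst, h]
  field_simp

lemma ballConst_add_two_le {n : ℕ} {c d : ℝ} (h : ballConst n ≤ c)
    (hd : c * (2 * 3.1416 / (n + 2)) ≤ d) : ballConst (n + 2) ≤ d := by
  rw [ballConst_add_two]
  refine le_trans ?_ hd
  have hc : 0 ≤ c := (ballConst_pos n).le.trans h
  have := Real.pi_lt_d4
  gcongr

lemma exists_ballConst_bound {n : ℕ} (hn : 1 ≤ n) (hn' : n ≤ 9) :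
    ∃ β : ℝ, 1 ≤ β ∧
      (∀ j < n, ballConst n ^ 2 * (1001 / 1000 * (n - 3 * (j : ℝ) / 4) / 4) ^ n ≤
        (β / 2 ^ j) ^ 2) ∧
      2 * Real.log 2 * β ≤ 2 ^ n ∧
      2 * Real.log 2 * (β - 1) + n * Real.log 2 / 2 ≤ 2 ^ n - 1 / 2 := by
  have hlog := Real.log_two_lt_d9
  have hlog0 : 0 < Real.log 2 := Real.log_pos one_lt_two
  have b1 : ballConst 1 ≤ 2 := ballConst_one.le
  have b2 : ballConst 2 ≤ 3.1416 := ballConst_add_two_le ballConst_zero.le (by norm_num)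
  have b3 : ballConst 3 ≤ 4.1888 := ballConst_add_two_le b1 (by norm_num)
  have b4 : ballConst 4 ≤ 4.93484 := ballConst_add_two_le b2 (by norm_num)
  have b5 : ballConst 5 ≤ 5.26382 := ballConst_add_two_le b3 (by norm_num)
  have b6 : ballConst 6 ≤ 5.16782 := ballConst_add_two_le b4 (by norm_num)
  have b7 : ballConst 7 ≤ 4.72488 := ballConst_add_two_le b5 (by norm_num)
  have b8 : ballConst 8 ≤ 4.05882 := ballConst_add_two_le b6 (by norm_num)
  have b9 : ballConst 9 ≤ 3.29862 := ballConst_add_two_le b7 (by norm_num)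
  have key : ∀ c β : ℝ, ballConst n ≤ c → 1 ≤ β →
      (∀ j < n, c ^ 2 * (1001 / 1000 * (n - 3 * (j : ℝ) / 4) / 4) ^ n ≤ (β / 2 ^ j) ^ 2) →
      2 * 0.6931471808 * β ≤ 2 ^ n →
      2 * 0.6931471808 * (β - 1) + n * 0.6931471808 / 2 ≤ (2 : ℝ) ^ n - 1 / 2 →
      ∃ β : ℝ, 1 ≤ β ∧
      (∀ j < n, ballConst n ^ 2 * (1001 / 1000 * (n - 3 * (j : ℝ) / 4) / 4) ^ n ≤
        (β / 2 ^ j) ^ 2) ∧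
      2 * Real.log 2 * β ≤ 2 ^ n ∧
      2 * Real.log 2 * (β - 1) + n * Real.log 2 / 2 ≤ 2 ^ n - 1 / 2 := by
    intro c β hc hβ h1 h2 h3
    refine ⟨β, hβ, fun j hj => ?_, ?_, ?_⟩
    · refine le_trans ?_ (h1 j hj)
      have hj' : (j : ℝ) < n := by exact_mod_cast hj
      have hj0 : (0 : ℝ) ≤ j := Nat.cast_nonneg j
      have := ballConst_pos n
      have : 0 ≤ n - 3 * (j : ℝ) / 4 := by linarith
      gcongr
    · nlinarith
    · have : (0 : ℝ) ≤ n := Nat.cast_nonneg n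
      nlinarith
  interval_cases n
  · exact key 2 1.01 b1 (by norm_num)
      (fun j hj => by interval_cases j; norm_num) (by norm_num) (by norm_num)
  · exact key _ 2 b2 (by norm_num)
      (fun j hj => by interval_cases j <;> norm_num) (by norm_num) (by norm_num)
  · exact key _ 5 b3 (by norm_num)
      (fun j hj => by interval_cases j <;> norm_num) (by norm_num) (by norm_num)
  · exact key _ 10 b4 (by norm_num)
      (fun j hj => by interval_cases j <;> norm_num) (by norm_num) (by norm_num)
  · exact key _ 20 b5 (by norm_num)
      (fun j hj => by interval_cases j <;> norm_num) (by norm_num) (by norm_num)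
  · exact key _ 40 b6 (by norm_num)
      (fun j hj => by interval_cases j <;> norm_num) (by norm_num) (by norm_num)
  · exact key _ 80 b7 (by norm_num)
      (fun j hj => by interval_cases j <;> norm_num) (by norm_num) (by norm_num)
  · exact key _ 170 b8 (by norm_num)
      (fun j hj => by interval_cases j <;> norm_num) (by norm_num) (by norm_num)
  · exact key _ 365 b9 (by norm_num)
      (fun j hj => by interval_cases j <;> norm_num) (by norm_num) (by norm_num)

lemma entropyBound_of_le_nine {n : ℕ} (hn : 1 ≤ n) (hn' : n ≤ 9) {w : (Fin n → ℝ) → ℝ}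
    (hw : Measurable w) (hpos : ∀ᵐ x, 0 < w x) (hloc : LocallyIntegrable w) {K : ℝ} (hK : 1 ≤ K)
    (hFW : ∀ Q : Set (Fin n → ℝ), IsCube Q →
      ∫⁻ x in Q, HLMax (Q.indicator w) x ≤
        ENNReal.ofReal K * ∫⁻ x in Q, ENNReal.ofReal (w x)) :
    ∃ C : ℝ, EntropyBound w C ∧ C + n * Real.log 2 / 2 ≤ 2 ^ n * K - 1 / 2 := by
  obtain ⟨β, hβ1, hβ, h1, h2⟩ := exists_ballConst_bound hn hn'
  refine ⟨_, entropyBound_of_ballConst hn hw hpos hloc hK hFW hβ1 hβ, ?_⟩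
  nlinarith

/-- The area of the slice at height `t` of the ball of radius `√(m + 1)` in `ℝᵐ⁺¹`, up to the
volume of the unit ball. -/
noncomputable def sliceArea (m : ℕ) (t : ℝ) : ℝ := √(m + 1 - t ^ 2) ^ m

lemma sliceArea_nonneg (m : ℕ) (t : ℝ) : 0 ≤ sliceArea m t := by unfold sliceArea; positivity

lemma continuous_sliceArea (m : ℕ) : Continuous (sliceArea m) := by unfold sliceArea; fun_prop

lemma sliceArea_neg (m : ℕ) (t : ℝ) : sliceArea m (-t) = sliceArea m t := by simp [sliceArea]

lemma sliceArea_eq (m : ℕ) {t : ℝ} (ht : t ^ 2 ≤ m + 1) :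
    sliceArea m t = √(m + 1) ^ m * (1 - t ^ 2 / (m + 1)) ^ ((m : ℝ) / 2) := by
  have h : (0 : ℝ) < m + 1 := by positivity
  have h1 : 0 ≤ 1 - t ^ 2 / (m + 1) := by rw [sub_nonneg, div_le_one h]; exact ht
  rw [Real.rpow_div_two_eq_sqrt _ h1, Real.rpow_natCast, ← mul_pow, ← Real.sqrt_mul h.le,
    sliceArea]
  congr 2
  field_simp

lemma sliceArea_eq_zero {m : ℕ} (hm : m ≠ 0) {t : ℝ} (ht : m + 1 ≤ t ^ 2) : sliceArea m t = 0 := by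
  rw [sliceArea, Real.sqrt_eq_zero_of_nonpos (by linarith), zero_pow hm]

lemma le_integral_sliceArea {m : ℕ} (hm : 2 ≤ m) :
    5 / 3 * √(m + 1) ^ m ≤ ∫ t in (-1)..1, sliceArea m t := by
  have hm' : (2 : ℝ) ≤ m := by exact_mod_cast hm
  have hN : (0 : ℝ) < m + 1 := by positivity
  have h : ∫ t in (-1 : ℝ)..1, √(m + 1) ^ m * (1 - t ^ 2 / 2) = 5 / 3 * √(m + 1) ^ m := by
    rw [intervalIntegral.integral_const_mul, intervalIntegral.integral_sub
      (by simp) (Continuous.intervalIntegrable (by fun_prop) _ _),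
      intervalIntegral.integral_div, integral_pow]
    norm_num
    ring
  rw [← h]
  refine intervalIntegral.integral_mono_on (by norm_num)
    (Continuous.intervalIntegrable (by fun_prop) _ _)
    ((continuous_sliceArea m).intervalIntegrable _ _) fun t ht => ?_
  have ht1 : t ^ 2 ≤ 1 := by nlinarith [ht.1, ht.2]
  rw [sliceArea_eq m (by linarith)]
  refine mul_le_mul_of_nonneg_left ?_ (by positivity)
  have hb := one_add_mul_self_le_rpow_one_add (s := -(t ^ 2 / (m + 1))) (p := (m : ℝ) / 2)
    (by rw [neg_le_neg_iff, div_le_one hN]; linarith) (by linarith)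
  rw [← sub_eq_add_neg] at hb
  refine le_trans ?_ hb
  have : (m : ℝ) / 2 * (t ^ 2 / (m + 1)) ≤ t ^ 2 / 2 := by
    rw [div_mul_div_comm, div_le_div_iff₀ (by positivity) two_pos]
    nlinarith [sq_nonneg t]
  linarith

lemma integral_sliceArea_le {m : ℕ} (hm : 2 ≤ m) :
    ∫ t in (1)..√(m + 1), sliceArea m t ≤ 1 / 2 * √(m + 1) ^ m := by
  have hm' : (2 : ℝ) ≤ m := by exact_mod_cast hm
  set N : ℝ := m + 1 with hN
  have hN0 : 0 < N := by positivity
  have h1N : 1 ≤ √N := by rw [Real.one_le_sqrt]; linarith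
  set p : ℝ := m / 2 with hp
  set G : ℝ → ℝ := fun t => -((1 / (4 * t) + N / (2 * (N + 1))) * (1 - t ^ 2 / N) ^ (p + 1)) with hG
  have hder : ∀ t : ℝ, 1 ≤ t → t ≤ √N → HasDerivAt G
      ((1 - t ^ 2 / N) ^ p * (1 / (4 * t ^ 2) + 1 / 4 + t / 2)) t := by
    intro t ht1 ht2
    have ht0 : 0 < t := by linarith
    have hu0 : 0 ≤ 1 - t ^ 2 / N := by
      rw [sub_nonneg, div_le_one hN0]
      calc t ^ 2 ≤ √N ^ 2 := by gcongr
        _ = N := Real.sq_sqrt hN0.le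
    have hu : HasDerivAt (fun t : ℝ => 1 - t ^ 2 / N) (-(2 * t / N)) t := by
      simpa using ((hasDerivAt_pow 2 t).div_const N).const_sub 1
    have hv := hu.rpow_const (p := p + 1) (Or.inr (by linarith))
    have hq : HasDerivAt (fun t : ℝ => 1 / (4 * t) + N / (2 * (N + 1))) (-(1 / (4 * t ^ 2))) t := by
      have : HasDerivAt (fun t : ℝ => 1 / (4 * t)) (-(1 / (4 * t ^ 2))) t := by
        have := ((hasDerivAt_inv ht0.ne').const_mul (1 / 4))
        refine (this.congr_deriv (by field_simp)).congr_of_eventuallyEq (Filter.Eventually.of_forall fun s => ?_)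
        simp [mul_comm]
      exact this.add_const _
    refine (hq.mul hv).neg.congr_deriv ?_
    rw [add_sub_cancel_right, Real.rpow_add_one' hu0 (by linarith)]
    have : p = (N - 1) / 2 := by rw [hp, hN]; ring
    have hN1 : N + 1 ≠ 0 := by linarith
    rw [show p + 1 = (N + 1) / 2 by linarith]
    generalize (1 - t ^ 2 / N) ^ p = g
    field_simp
    ring
  have hle := intervalIntegral.integral_le_sub_of_hasDeriv_right_of_le
    (g := G) (φ := fun t => (1 - t ^ 2 / N) ^ p) h1N
    (fun t ht => (hder t ht.1 ht.2).continuousAt.continuousWithinAt)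
    (fun t ht => (hder t ht.1.le ht.2.le).hasDerivWithinAt)
    (Continuous.integrableOn_Icc (Continuous.rpow_const (by fun_prop)
      fun _ => Or.inr (by linarith))) (fun t ht => ?_)
  · have hGN : G √N = 0 := by
      simp only [hG]
      rw [Real.sq_sqrt hN0.le, div_self hN0.ne', sub_self, Real.zero_rpow (by linarith)]
      simp
    have hG1 : -G 1 ≤ 1 / 2 := by
      simp only [hG, neg_neg]
      have h34 : 1 / (4 * 1) + N / (2 * (N + 1)) ≤ 3 / 4 := by
        have : N / (2 * (N + 1)) ≤ 1 / 2 := by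
          rw [div_le_div_iff₀ (by positivity) two_pos]
          linarith
        linarith
      have h1N' : 1 / N ≤ 1 := by rw [div_le_one hN0]; linarith
      have he : (1 - 1 ^ 2 / N) ^ (p + 1) ≤ 2 / 3 := by
        have h1 : (1 - 1 ^ 2 / N) ≤ Real.exp (-(1 / N)) := by
          have := Real.add_one_le_exp (-(1 / N))
          rw [one_pow]
          linarith
        calc (1 - 1 ^ 2 / N) ^ (p + 1) ≤ Real.exp (-(1 / N)) ^ (p + 1) := by
              refine Real.rpow_le_rpow (by rw [one_pow]; linarith) h1 (by linarith)
          _ = Real.exp (-(1 / N) * (p + 1)) := (Real.exp_mul _ _).symm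
          _ ≤ Real.exp (-(1 / 2)) := by
              refine Real.exp_le_exp.2 ?_
              have : 1 / 2 ≤ 1 / N * (p + 1) := by
                rw [one_div_mul_eq_div, div_le_div_iff₀ two_pos hN0, hp, hN]
                linarith
              linarith
          _ ≤ 2 / 3 := by
              rw [Real.exp_neg, inv_le_comm₀ (Real.exp_pos _) (by norm_num)]
              have := Real.add_one_le_exp (1 / 2 : ℝ)
              norm_num at this ⊢
              exact this
      calc _ ≤ 3 / 4 * (2 / 3 : ℝ) := by
            gcongr
            exact Real.rpow_nonneg (by rw [one_pow]; linarith) _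
        _ = _ := by norm_num
    have hcongr : ∫ t in (1)..√N, sliceArea m t =
        ∫ t in (1)..√N, √N ^ m * (1 - t ^ 2 / N) ^ p := by
      refine intervalIntegral.integral_congr fun t ht => ?_
      rw [Set.uIcc_of_le h1N] at ht
      refine sliceArea_eq m ?_
      calc t ^ 2 ≤ √N ^ 2 := by gcongr; linarith [ht.1]; exact ht.2
        _ = N := Real.sq_sqrt hN0.le
    rw [hcongr, intervalIntegral.integral_const_mul, mul_comm]
    refine mul_le_mul_of_nonneg_right ?_ (by positivity)
    linarith
  · have ht0 : 0 < t := by linarith [ht.1]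
    have hu0 : 0 ≤ 1 - t ^ 2 / N := by
      rw [sub_nonneg, div_le_one hN0]
      calc t ^ 2 ≤ √N ^ 2 := by gcongr; exact ht.2.le
        _ = N := Real.sq_sqrt hN0.le
    refine le_mul_of_one_le_right (Real.rpow_nonneg hu0 _) ?_
    have h : 1 / (4 * t ^ 2) + 1 / 4 + t / 2 - 1 = (t - 1) ^ 2 * (2 * t + 1) / (4 * t ^ 2) := by
      field_simp
      ring
    have : 0 ≤ (t - 1) ^ 2 * (2 * t + 1) / (4 * t ^ 2) := by positivity
    linarith

lemma ofReal_le_lintegral_sliceArea {m : ℕ} (hm : 2 ≤ m) :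
    ENNReal.ofReal (5 / 3 * √(m + 1) ^ m) ≤
      ∫⁻ t in Set.Ioc (-1 : ℝ) 1, ENNReal.ofReal (sliceArea m t) := by
  rw [← ofReal_integral_eq_lintegral_ofReal (continuous_sliceArea m).integrableOn_Ioc
    (Filter.Eventually.of_forall fun t => sliceArea_nonneg m t),
    ← intervalIntegral.integral_of_le (by norm_num)]
  exact ENNReal.ofReal_le_ofReal (le_integral_sliceArea hm)

lemma lintegral_sliceArea_Ioi_le {m : ℕ} (hm : 2 ≤ m) :
    ∫⁻ t in Set.Ioi (1 : ℝ), ENNReal.ofReal (sliceArea m t) ≤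
      ENNReal.ofReal (1 / 2 * √(m + 1) ^ m) := by
  have h1N : 1 ≤ √((m : ℝ) + 1) := by rw [Real.one_le_sqrt]; linarith [Nat.cast_nonneg (α := ℝ) m]
  have h : ∫⁻ t in Set.Ioi (1 : ℝ), ENNReal.ofReal (sliceArea m t) =
      ∫⁻ t in Set.Ioc (1 : ℝ) √(m + 1), ENNReal.ofReal (sliceArea m t) := by
    rw [← Set.Ioc_union_Ioi_eq_Ioi h1N, lintegral_union measurableSet_Ioi
      (Set.disjoint_left.2 fun x hx hx' => not_lt.2 hx.2 hx')]
    convert add_zero _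
    refine setLIntegral_eq_zero measurableSet_Ioi fun t ht => ?_
    rw [sliceArea_eq_zero (by omega), ENNReal.ofReal_zero, Pi.zero_apply]
    rw [← Real.sq_sqrt (show (0 : ℝ) ≤ m + 1 by positivity)]
    gcongr
    exact le_of_lt ht
  rw [h, ← ofReal_integral_eq_lintegral_ofReal (continuous_sliceArea m).integrableOn_Ioc
    (Filter.Eventually.of_forall fun t => sliceArea_nonneg m t),
    ← intervalIntegral.integral_of_le h1N]
  exact ENNReal.ofReal_le_ofReal (integral_sliceArea_le hm)

/-- The volume of a horizontal piece of the ball of radius `√(m + 1)`, by slicing. -/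
lemma volume_euclBall_inter_slab {m : ℕ} (hm : 0 < m) (i : Fin (m + 1)) {T : Set ℝ}
    (hT : MeasurableSet T) :
    volume {z : Fin (m + 1) → ℝ | z ∈ euclBall 0 √(m + 1) ∧ z i ∈ T} =
      ENNReal.ofReal (ballConst m) * ∫⁻ t in T, ENNReal.ofReal (sliceArea m t) := by
  have hN : (0 : ℝ) < m + 1 := by positivity
  set S : Set (ℝ × (Fin m → ℝ)) := {q | q.1 ^ 2 + ∑ j, q.2 j ^ 2 < m + 1 ∧ q.1 ∈ T} with hS
  have hSm : MeasurableSet S := by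
    have h1 : MeasurableSet {q : ℝ × (Fin m → ℝ) | q.1 ^ 2 + ∑ j, q.2 j ^ 2 < m + 1} :=
      measurableSet_lt (by fun_prop) measurable_const
    exact h1.inter (measurable_fst hT)
  have hpre : {z : Fin (m + 1) → ℝ | z ∈ euclBall 0 √(m + 1) ∧ z i ∈ T} =
      MeasurableEquiv.piFinSuccAbove (fun _ => ℝ) i ⁻¹' S := by
    ext z
    have : z ∈ euclBall 0 √(m + 1) ↔ z i ^ 2 + ∑ j, z (i.succAbove j) ^ 2 < (m : ℝ) + 1 := by
      rw [mem_euclBall (Real.sqrt_pos.2 hN), Real.sq_sqrt hN.le, Fin.sum_univ_succAbove _ i]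
      simp
    simp only [Set.mem_ofPred_eq, this]
    rfl
  rw [hpre, (volume_preserving_piFinSuccAbove (fun _ => ℝ) i).measure_preimage
    hSm.nullMeasurableSet, Measure.volume_eq_prod, Measure.prod_apply hSm,
    ← lintegral_const_mul' _ _ ENNReal.ofReal_ne_top, ← lintegral_indicator hT]
  refine lintegral_congr fun t => ?_
  by_cases ht : t ∈ T
  · rw [Set.indicator_of_mem ht]
    rcases lt_or_ge (t ^ 2) (m + 1) with h | h
    · have : Prod.mk t ⁻¹' S = euclBall 0 √(m + 1 - t ^ 2) := by
        ext q
        rw [mem_euclBall (Real.sqrt_pos.2 (sub_pos.2 h)), Real.sq_sqrt (sub_pos.2 h).le]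
        simp [hS, ht, lt_sub_iff_add_lt']
      rw [this, volume_euclBall hm _ (Real.sqrt_pos.2 (sub_pos.2 h)), mul_comm,
        ENNReal.ofReal_mul (ballConst_pos m).le, sliceArea]
    · have : Prod.mk t ⁻¹' S = ∅ := by
        ext q
        have : 0 ≤ ∑ j, q j ^ 2 := Finset.sum_nonneg fun j _ => sq_nonneg _
        simp only [hS, Set.mem_preimage, Set.mem_ofPred_eq, Set.mem_empty_iff_false, iff_false,
          not_and]
        intro h'
        linarith
      rw [this, sliceArea_eq_zero hm.ne' h]
      simp
  · rw [Set.indicator_of_notMem ht]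
    have : Prod.mk t ⁻¹' S = ∅ := by
      ext q
      simp [hS, ht]
    simp [this]

/-- At most three eighths of the ball of radius `√n` has a given coordinate of size at least
one. -/
lemma volume_euclBall_one_le_abs {n : ℕ} (hn : 3 ≤ n) (i : Fin n) :
    volume {z : Fin n → ℝ | z ∈ euclBall 0 √n ∧ 1 ≤ |z i|} ≤
      ENNReal.ofReal (3 / 8) * volume (euclBall (0 : Fin n → ℝ) √n) := by
  obtain ⟨m, rfl⟩ : ∃ m, n = m + 1 := ⟨n - 1, by omega⟩
  have hm : 2 ≤ m := by omega
  push_cast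
  have key := fun T hT => volume_euclBall_inter_slab (m := m) (by omega) i (T := T) hT
  set B : Set (Fin (m + 1) → ℝ) := euclBall 0 √(m + 1) with hB
  set κ : ℝ := √(m + 1) ^ m with hκ
  have hκ0 : 0 ≤ κ := by positivity
  have hup : ∫⁻ t in Set.Ici (1 : ℝ), ENNReal.ofReal (sliceArea m t) ≤ ENNReal.ofReal (1 / 2 * κ) := by
    rw [setLIntegral_congr Ioi_ae_eq_Ici.symm]
    exact lintegral_sliceArea_Ioi_le hm
  have hlow : ∫⁻ t in Set.Iic (-1 : ℝ), ENNReal.ofReal (sliceArea m t) ≤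
      ENNReal.ofReal (1 / 2 * κ) := by
    have := (Measure.measurePreserving_neg (volume : Measure ℝ)).setLIntegral_comp_preimage
      (measurableSet_Ici (a := (1 : ℝ))) (continuous_sliceArea m).measurable.ennreal_ofReal
    simp only [sliceArea_neg] at this
    rw [← this] at hup
    convert hup using 3
    ext t
    simp [le_neg]
  have hin := ofReal_le_lintegral_sliceArea hm
  set b := ENNReal.ofReal (ballConst m)
  have hout : volume {z | z ∈ B ∧ 1 ≤ |z i|} ≤ b * ENNReal.ofReal κ := by
    calc volume {z | z ∈ B ∧ 1 ≤ |z i|}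
        ≤ volume ({z | z ∈ B ∧ z i ∈ Set.Iic (-1)} ∪ {z | z ∈ B ∧ z i ∈ Set.Ici 1}) := by
          refine measure_mono fun z hz => ?_
          rcases le_abs.1 hz.2 with h | h
          · exact Or.inr ⟨hz.1, h⟩
          · exact Or.inl ⟨hz.1, le_neg.1 h⟩
      _ ≤ _ := measure_union_le _ _
      _ ≤ b * ENNReal.ofReal (1 / 2 * κ) + b * ENNReal.ofReal (1 / 2 * κ) := by
          rw [key _ measurableSet_Iic, key _ measurableSet_Ici]
          gcongr
      _ = b * ENNReal.ofReal κ := by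
          rw [← mul_add, ← ENNReal.ofReal_add (by positivity) (by positivity)]
          congr 2
          ring
  have hinner : b * ENNReal.ofReal (5 / 3 * κ) ≤ volume {z | z ∈ B ∧ |z i| < 1} := by
    calc b * ENNReal.ofReal (5 / 3 * κ)
        ≤ b * ∫⁻ t in Set.Ioo (-1 : ℝ) 1, ENNReal.ofReal (sliceArea m t) := by
          rw [setLIntegral_congr Ioo_ae_eq_Ioc]
          gcongr
      _ = volume {z | z ∈ B ∧ z i ∈ Set.Ioo (-1) 1} := (key _ measurableSet_Ioo).symm
      _ = _ := by
          congr 1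
          ext z
          simp [abs_lt]
  have hsplit : volume B = volume {z | z ∈ B ∧ |z i| < 1} + volume {z | z ∈ B ∧ 1 ≤ |z i|} := by
    rw [← measure_inter_add_sdiff B (measurableSet_lt (measurable_pi_apply i).abs measurable_const :
      MeasurableSet {z : Fin (m + 1) → ℝ | |z i| < 1})]
    congr 2
    ext z
    simp
  set out := volume {z | z ∈ B ∧ 1 ≤ |z i|}
  calc out = ENNReal.ofReal (5 / 8) * out + ENNReal.ofReal (3 / 8) * out := by
        rw [← add_mul, ← ENNReal.ofReal_add (by norm_num) (by norm_num)]
        norm_num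
    _ ≤ ENNReal.ofReal (5 / 8) * (b * ENNReal.ofReal κ) + ENNReal.ofReal (3 / 8) * out := by gcongr
    _ = ENNReal.ofReal (3 / 8) * (b * ENNReal.ofReal (5 / 3 * κ)) + ENNReal.ofReal (3 / 8) * out := by
        congr 1
        rw [mul_left_comm, mul_left_comm _ b, ← ENNReal.ofReal_mul (p := 5 / 8) (by norm_num),
          ← ENNReal.ofReal_mul (p := 3 / 8) (by norm_num)]
        congr 2
        ring
    _ ≤ _ := by
        rw [hsplit, mul_add]
        gcongr

/-- The part of the ball of radius `√n` on which each coordinate, with the sign prescribed by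
`ε`, exceeds `-1`. -/
def signedBall {n : ℕ} (ε : Fin n → Bool) : Set (Fin n → ℝ) :=
  {z | z ∈ euclBall 0 √n ∧ ∀ i, -1 < (bif ε i then 1 else -1) * z i}

lemma measurableSet_signedBall {n : ℕ} (ε : Fin n → Bool) : MeasurableSet (signedBall ε) := by
  have h : signedBall ε =
      euclBall 0 √n ∩ ⋂ i, {z : Fin n → ℝ | -1 < (bif ε i then 1 else -1) * z i} := by
    ext
    simp [signedBall]
  rw [h]
  exact (measurableSet_euclBall _ _).inter (MeasurableSet.iInter fun i =>
    measurableSet_lt measurable_const ((measurable_pi_apply i).const_mul _))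

lemma volume_signedBall {n : ℕ} (ε : Fin n → Bool) :
    volume (signedBall ε) = volume (signedBall fun _ : Fin n => true) := by
  have hmp : MeasurePreserving (fun (z : Fin n → ℝ) i => (bif ε i then 1 else -1) * z i) := by
    refine volume_preserving_pi (f := fun i (t : ℝ) => (bif ε i then 1 else -1) * t) fun i => ?_
    cases ε i
    · simpa using Measure.measurePreserving_neg (volume : Measure ℝ)
    · simp only [cond_true, one_mul]
      exact MeasurePreserving.id _
  rw [← hmp.measure_preimage (measurableSet_signedBall fun _ => true).nullMeasurableSet]
  congr 1
  ext z
  have : ∀ i, ((bif ε i then 1 else -1) * z i) ^ 2 = z i ^ 2 := fun i => by cases ε i <;> simp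
  simp [signedBall, euclBall, euclNorm, this]

lemma prod_sign_indicator_ge {n : ℕ} (z : Fin n → ℝ) :
    (2 : ℝ≥0∞) ^ n * ENNReal.ofReal ((2 : ℝ) ^ (-∑ i, (if 1 ≤ |z i| then (1 : ℝ) else 0))) ≤
      ∑ ε : Fin n → Bool, ∏ i, (if -1 < (bif ε i then 1 else -1) * z i then (1 : ℝ≥0∞) else 0) := by
  have h := Finset.prod_univ_sum (fun _ : Fin n => (Finset.univ : Finset Bool))
    (fun i b => (if -1 < (bif b then 1 else -1) * z i then (1 : ℝ≥0∞) else 0))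
  rw [Fintype.piFinset_univ] at h
  rw [← h, ← Finset.sum_neg_distrib, Real.rpow_sum_of_pos two_pos,
    ENNReal.ofReal_prod_of_nonneg (fun i _ => by positivity)]
  have h2 : (2 : ℝ≥0∞) ^ n = ∏ _i : Fin n, (2 : ℝ≥0∞) := by simp
  rw [h2, ← Finset.prod_mul_distrib]
  refine Finset.prod_le_prod' fun i _ => ?_
  rw [Fintype.sum_bool]
  simp only [cond_true, cond_false, one_mul, neg_mul, neg_lt_neg_iff]
  by_cases h1 : 1 ≤ |z i|
  · rw [if_pos h1, Real.rpow_neg_one, ENNReal.ofReal_inv_of_pos two_pos, ENNReal.ofReal_ofNat,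
      ENNReal.mul_inv_cancel two_ne_zero (by simp)]
    rcases lt_or_ge (-1) (z i) with h | h
    · rw [if_pos h]
      exact le_self_add
    · rw [if_pos (show z i < 1 by linarith)]
      exact le_add_self
  · have h2 := abs_lt.1 (not_le.1 h1)
    rw [if_neg h1, if_pos h2.1, if_pos h2.2]
    norm_num

lemma volume_le_volume_signedBall {n : ℕ} (hn : 3 ≤ n) (ε : Fin n → Bool) :
    ENNReal.ofReal (2 ^ (-(3 / 8 * n : ℝ))) * volume (euclBall (0 : Fin n → ℝ) √n) ≤
      volume (signedBall ε) := by
  set B : Set (Fin n → ℝ) := euclBall 0 √n with hB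
  have hBm : MeasurableSet B := measurableSet_euclBall _ _
  have hBt : volume B ≠ ∞ := volume_euclBall_ne_top (by omega) _ (by positivity)
  set V := volume (signedBall ε) with hV
  set c : Fin n → (Fin n → ℝ) → ℝ := fun i z => if 1 ≤ |z i| then 1 else 0 with hc
  have hcm : ∀ i, Measurable (c i) := fun i =>
    Measurable.ite (measurableSet_le measurable_const (measurable_pi_apply i).abs)
      measurable_const measurable_const
  have hc0 : ∀ i z, 0 ≤ c i z := fun i z => by simp only [hc]; split_ifs <;> norm_num
  have hsum : (2 : ℝ≥0∞) ^ n * ∫⁻ z in B, ENNReal.ofReal (2 ^ (-∑ i, c i z)) ≤ 2 ^ n * V := by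
    calc (2 : ℝ≥0∞) ^ n * ∫⁻ z in B, ENNReal.ofReal (2 ^ (-∑ i, c i z))
        = ∫⁻ z in B, (2 : ℝ≥0∞) ^ n * ENNReal.ofReal (2 ^ (-∑ i, c i z)) :=
          (lintegral_const_mul' _ _ (by simp)).symm
      _ ≤ ∫⁻ z in B, ∑ δ : Fin n → Bool,
            ∏ i, (if -1 < (bif δ i then 1 else -1) * z i then (1 : ℝ≥0∞) else 0) :=
          lintegral_mono fun z => prod_sign_indicator_ge z
      _ = ∫⁻ z in B, ∑ δ : Fin n → Bool, (signedBall δ).indicator 1 z := by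
          refine setLIntegral_congr_fun hBm fun z hz => ?_
          refine Finset.sum_congr rfl fun δ _ => ?_
          rw [Finset.prod_ite_zero]
          simp only [Finset.prod_const_one, Set.indicator, signedBall, Set.mem_ofPred_eq, ← hB, hz,
            true_and, Finset.mem_univ, true_imp_iff, Pi.one_apply]
      _ ≤ ∫⁻ z, ∑ δ : Fin n → Bool, (signedBall δ).indicator 1 z := setLIntegral_le_lintegral _ _
      _ = ∑ δ : Fin n → Bool, volume (signedBall δ) := by
          rw [lintegral_finsetSum _ fun δ _ =>
            measurable_one.indicator (measurableSet_signedBall δ)]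
          simp only [lintegral_indicator_one (measurableSet_signedBall _)]
      _ = 2 ^ n * V := by
          simp only [hV, volume_signedBall]
          simp
  have hV' : ∫⁻ z in B, ENNReal.ofReal (2 ^ (-∑ i, c i z)) ≤ V :=
    (ENNReal.mul_le_mul_iff_right (by simp) (by simp)).1 hsum
  set t : ℝ := 2 ^ (-(3 / 8 * n : ℝ)) with ht
  have ht0 : 0 < t := by positivity
  have hlog : 0 < Real.log 2 := Real.log_pos one_lt_two
  have htan : ∀ z, t * (1 + 3 / 8 * n * Real.log 2) ≤
      2 ^ (-∑ i, c i z) + t * Real.log 2 * ∑ i, c i z := by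
    intro z
    set s := ∑ i, c i z
    have h1 : (2 : ℝ) ^ (-s) = t * Real.exp ((3 / 8 * n - s) * Real.log 2) := by
      rw [ht, mul_comm (3 / 8 * n - s), ← Real.rpow_def_of_pos two_pos, ← Real.rpow_add two_pos]
      congr 1
      ring
    have h2 := Real.add_one_le_exp ((3 / 8 * n - s) * Real.log 2)
    rw [h1]
    nlinarith
  have hcount : ∫⁻ z in B, ENNReal.ofReal (∑ i, c i z) ≤ ENNReal.ofReal (3 / 8 * n) * volume B := by
    calc ∫⁻ z in B, ENNReal.ofReal (∑ i, c i z) = ∫⁻ z in B, ∑ i, ENNReal.ofReal (c i z) := by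
          simp only [ENNReal.ofReal_sum_of_nonneg fun i _ => hc0 i _]
      _ = ∑ i, ∫⁻ z in B, ENNReal.ofReal (c i z) :=
          lintegral_finsetSum _ fun i _ => (hcm i).ennreal_ofReal
      _ ≤ ∑ _i : Fin n, ENNReal.ofReal (3 / 8) * volume B := by
          refine Finset.sum_le_sum fun i _ => ?_
          refine le_of_eq_of_le ?_ (volume_euclBall_one_le_abs hn i)
          have hm : MeasurableSet {z : Fin n → ℝ | 1 ≤ |z i|} :=
            measurableSet_le measurable_const (measurable_pi_apply i).abs
          have : ∀ z, ENNReal.ofReal (c i z) = {z : Fin n → ℝ | 1 ≤ |z i|}.indicator 1 z := by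
            intro z
            simp only [hc, Set.indicator, Set.mem_ofPred_eq, Pi.one_apply]
            split_ifs <;> simp
          simp only [this]
          rw [lintegral_indicator_one hm, Measure.restrict_apply hm, Set.inter_comm]
          rfl
      _ = _ := by
          rw [Finset.sum_const, Finset.card_univ, Fintype.card_fin, nsmul_eq_mul, ← mul_assoc,
            mul_comm (3 / 8 : ℝ), ENNReal.ofReal_mul (Nat.cast_nonneg n), ENNReal.ofReal_natCast]
  have hcm' : Measurable fun z => ∑ i, c i z := Finset.measurable_fun_sum _ fun i _ => hcm i
  have hmain : ENNReal.ofReal (t * (1 + 3 / 8 * n * Real.log 2)) * volume B ≤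
      V + ENNReal.ofReal (t * Real.log 2) * (ENNReal.ofReal (3 / 8 * n) * volume B) := by
    calc ENNReal.ofReal (t * (1 + 3 / 8 * n * Real.log 2)) * volume B
        = ∫⁻ _ in B, ENNReal.ofReal (t * (1 + 3 / 8 * n * Real.log 2)) := by simp
      _ ≤ ∫⁻ z in B, (ENNReal.ofReal (2 ^ (-∑ i, c i z)) +
            ENNReal.ofReal (t * Real.log 2) * ENNReal.ofReal (∑ i, c i z)) := by
          refine lintegral_mono fun z => ?_
          rw [← ENNReal.ofReal_mul (by positivity), ← ENNReal.ofReal_add (by positivity)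
            (mul_nonneg (by positivity) (Finset.sum_nonneg fun i _ => hc0 i z))]
          exact ENNReal.ofReal_le_ofReal (htan z)
      _ = _ := by
          rw [lintegral_add_right _ (hcm'.ennreal_ofReal.const_mul _),
            lintegral_const_mul' _ _ ENNReal.ofReal_ne_top]
      _ ≤ _ := by gcongr
  rw [show t * (1 + 3 / 8 * n * Real.log 2) = t + t * Real.log 2 * (3 / 8 * n) by ring,
    ENNReal.ofReal_add ht0.le (by positivity), add_mul, ENNReal.ofReal_mul (by positivity),
    mul_assoc (ENNReal.ofReal (t * Real.log 2))] at hmain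
  refine (ENNReal.add_le_add_iff_right ?_).1 hmain
  exact ENNReal.mul_ne_top ENNReal.ofReal_ne_top (ENNReal.mul_ne_top ENNReal.ofReal_ne_top hBt)

lemma two_pow_le_volume_signedBall {n : ℕ} (hn : 0 < n) (ε : Fin n → Bool) :
    (2 : ℝ≥0∞) ^ n ≤ volume (signedBall ε) := by
  have : Nonempty (Fin n) := Fin.pos_iff_nonempty.1 hn
  have hsub : (Set.univ.pi fun _ : Fin n => Set.Ioo (-1 : ℝ) 1) ⊆ signedBall ε := by
    intro z hz
    have hz' : ∀ i, -1 < z i ∧ z i < 1 := fun i => hz i trivial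
    refine ⟨?_, fun i => ?_⟩
    · rw [mem_euclBall (by positivity), Real.sq_sqrt (by positivity)]
      calc ∑ i, (z i - (0 : Fin n → ℝ) i) ^ 2 < ∑ _i : Fin n, (1 : ℝ) := by
            refine Finset.sum_lt_sum_of_nonempty Finset.univ_nonempty fun i _ => ?_
            rw [Pi.zero_apply, sub_zero]
            nlinarith [hz' i]
        _ = n := by simp
    · cases ε i <;> simp <;> linarith [hz' i]
  refine le_trans (le_of_eq ?_) (measure_mono hsub)
  rw [volume_pi_pi]
  norm_num

lemma volume_preimage_affine {n : ℕ} {s : ℝ} (hs : 0 < s) (d : Fin n → ℝ) (T : Set (Fin n → ℝ)) :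
    volume ((fun (x : Fin n → ℝ) i => s * x i + d i) ⁻¹' T) =
      ENNReal.ofReal ((s ^ n)⁻¹) * volume T := by
  have h : (fun (x : Fin n → ℝ) i => s * x i + d i) ⁻¹' T = (s • ·) ⁻¹' ((· + d) ⁻¹' T) := rfl
  rw [h, Measure.addHaar_preimage_smul _ hs.ne', measure_preimage_add_right,
    Module.finrank_fin_fun, abs_of_pos (by positivity)]

section RobustCube

variable {n : ℕ} {w : (Fin n → ℝ) → ℝ} {b : Fin n → ℝ} {l : ℝ}

/-- The dilation by `1 + 2 / (5 n)` about the centre of the cube with corner `b` and side `l`. -/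
noncomputable def cubeDilation (b : Fin n → ℝ) (l : ℝ) (x : Fin n → ℝ) : Fin n → ℝ :=
  fun i => b i + l / 2 + (1 + 2 / (5 * n)) * (x i - (b i + l / 2))

/-- The points of the cube whose dilates are close to `y`. -/
noncomputable def dilationNbhd (b : Fin n → ℝ) (l : ℝ) (y : Fin n → ℝ) : Set (Fin n → ℝ) :=
  {x | (fun i => (cubeDilation b l x i - y i) / (l / (5 * n))) ∈
    signedBall fun i => decide (y i < b i + l / 2)}

lemma measurable_cubeDilation : Measurable (cubeDilation b l) := by
  refine measurable_pi_lambda _ fun i => ?_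
  unfold cubeDilation
  fun_prop

lemma mem_euclBall_cubeDilation (hn : 0 < n) (hl : 0 < l) {x : Fin n → ℝ}
    (hx : ∀ i, |x i - (b i + l / 2)| < l / 2) :
    x ∈ euclBall (cubeDilation b l x) (l / (5 * n) * √n) := by
  have : Nonempty (Fin n) := Fin.pos_iff_nonempty.1 hn
  have hn' : (0 : ℝ) < n := by exact_mod_cast hn
  rw [mem_euclBall (by positivity), mul_pow, Real.sq_sqrt hn'.le]
  calc ∑ i, (x i - cubeDilation b l x i) ^ 2 < ∑ _i : Fin n, (l / (5 * n)) ^ 2 := by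
        refine Finset.sum_lt_sum_of_nonempty Finset.univ_nonempty fun i _ => ?_
        have h : x i - cubeDilation b l x i = -(2 / (5 * n) * (x i - (b i + l / 2))) := by
          unfold cubeDilation
          ring
        rw [h, neg_sq, ← sq_abs, abs_mul, abs_of_pos (show (0 : ℝ) < 2 / (5 * n) by positivity)]
        have : 2 / (5 * n) * |x i - (b i + l / 2)| < l / (5 * n) :=
          calc _ < 2 / (5 * n) * (l / 2) := mul_lt_mul_of_pos_left (hx i) (by positivity)
            _ = _ := by field_simp
        gcongr
    _ = _ := by simp [mul_comm]

lemma dilationNbhd_spec (hn : 3 ≤ n) (hl : 0 < l) {x y : Fin n → ℝ} (hy : y ∈ box b fun _ => l)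
    (hx : x ∈ dilationNbhd b l y) :
    (∀ i, |x i - (b i + l / 2)| < l / 2) ∧ y ∈ euclBall (cubeDilation b l x) (l / (5 * n) * √n) := by
  have hn' : (3 : ℝ) ≤ n := by exact_mod_cast hn
  have hn0 : (0 : ℝ) < n := by linarith
  set ρ := l / (5 * n) with hρ
  have hρ0 : 0 < ρ := by positivity
  obtain ⟨hz, hsgn⟩ := hx
  rw [mem_euclBall (by positivity), Real.sq_sqrt hn0.le] at hz
  simp only [Pi.zero_apply, sub_zero] at hz
  constructor
  · intro i
    have hzi : ((cubeDilation b l x i - y i) / ρ) ^ 2 < n :=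
      (Finset.single_le_sum (f := fun i => ((cubeDilation b l x i - y i) / ρ) ^ 2)
        (fun j _ => sq_nonneg _) (Finset.mem_univ i)).trans_lt hz
    have hyi := hy i trivial
    have hs := hsgn i
    set z := (cubeDilation b l x i - y i) / ρ with hzdef
    have heq : (1 + 2 / (5 * n)) * (x i - (b i + l / 2)) = y i - (b i + l / 2) + ρ * z := by
      rw [hzdef, mul_div_cancel₀ _ hρ0.ne']
      unfold cubeDilation
      ring
    have hθ : (1 + 2 / (5 * n)) * (l / 2) = l / 2 + ρ := by
      rw [hρ]
      field_simp
    have hsz : (ρ * z) ^ 2 < (l / 2) ^ 2 := by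
      calc (ρ * z) ^ 2 = ρ ^ 2 * z ^ 2 := mul_pow _ _ _
        _ < ρ ^ 2 * n := by gcongr
        _ ≤ (l / 2) ^ 2 := by
          rw [hρ, div_pow, div_pow, div_mul_eq_mul_div, div_le_div_iff₀ (by positivity) (by positivity)]
          nlinarith [sq_nonneg l, mul_nonneg (sq_nonneg l) hn0.le, mul_nonneg (mul_nonneg (sq_nonneg l) hn0.le) hn0.le]
    have hab := abs_lt.1 (abs_lt_of_sq_lt_sq hsz (by positivity))
    have key : (1 + 2 / (5 * n)) * |x i - (b i + l / 2)| < (1 + 2 / (5 * n)) * (l / 2) := by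
      rw [← abs_of_pos (show (0 : ℝ) < 1 + 2 / (5 * n) by positivity), ← abs_mul,
        abs_of_pos (show (0 : ℝ) < 1 + 2 / (5 * n) by positivity), heq, hθ, abs_lt]
      by_cases h : y i < b i + l / 2
      · have : -1 < z := by simpa [h] using hs
        constructor <;> nlinarith [hyi.1, hyi.2, hab.1, hab.2]
      · have : z < 1 := by simpa [h] using hs
        constructor <;> nlinarith [hyi.1, hyi.2, hab.1, hab.2]
    exact lt_of_mul_lt_mul_left key (by positivity)
  · rw [mem_euclBall (by positivity), mul_pow, Real.sq_sqrt hn0.le]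
    calc ∑ i, (y i - cubeDilation b l x i) ^ 2 =
        ρ ^ 2 * ∑ i, ((cubeDilation b l x i - y i) / ρ) ^ 2 := by
          rw [Finset.mul_sum]
          refine Finset.sum_congr rfl fun i _ => ?_
          field_simp
          ring
      _ < ρ ^ 2 * n := by gcongr

lemma volume_dilationNbhd (hn : 0 < n) (hl : 0 < l) (y : Fin n → ℝ) :
    volume (dilationNbhd b l y) = ENNReal.ofReal ((l / (5 * n + 2)) ^ n) *
      volume (signedBall fun i => decide (y i < b i + l / 2)) := by
  have hn' : (0 : ℝ) < n := by exact_mod_cast hn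
  have h := volume_preimage_affine (s := (5 * n + 2) / l) (by positivity)
    (fun i => (b i + l / 2 - (1 + 2 / (5 * n)) * (b i + l / 2) - y i) / (l / (5 * n)))
    (signedBall fun i => decide (y i < b i + l / 2))
  rw [← inv_pow, inv_div] at h
  rw [← h]
  congr 1
  ext x
  change _ ∈ signedBall _ ↔ _ ∈ signedBall _
  refine iff_of_eq (congrArg (· ∈ signedBall _) (funext fun i => ?_))
  unfold cubeDilation
  field_simp
  ring

lemma measurableSet_dilationNbhd (y : Fin n → ℝ) : MeasurableSet (dilationNbhd b l y) := by
  have hm : Measurable fun (x : Fin n → ℝ) i => (cubeDilation b l x i - y i) / (l / (5 * n)) := by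
    refine measurable_pi_lambda _ fun i => ?_
    exact (((measurable_pi_apply i).comp measurable_cubeDilation).sub_const _).div_const _
  exact hm (measurableSet_signedBall _)

/-- Small sets occupy only a small part of each neighbourhood. -/
lemma le_volume_dilationNbhd_diff (hn : 3 ≤ n) (hl : 0 < l) {B : Set (Fin n → ℝ)}
    (hBv : ENNReal.ofReal (10 * ((5 * n + 2) / 2) ^ n) * volume B ≤ volume (box b fun _ => l))
    (y : Fin n → ℝ) :
    ENNReal.ofReal (9 / 10 * 2 ^ (-(3 / 8 * n : ℝ)) * ((1 + 2 / (5 * n : ℝ)) ^ n)⁻¹) *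
      volume (euclBall (0 : Fin n → ℝ) (l / (5 * n) * √n)) ≤ volume (dilationNbhd b l y \ B) := by
  have hn0 : 0 < n := by omega
  have hn' : (0 : ℝ) < n := by exact_mod_cast hn0
  have hvol := volume_dilationNbhd (b := b) hn0 hl y
  set ε : Fin n → Bool := fun i => decide (y i < b i + l / 2)
  set T := volume (dilationNbhd b l y)
  have h1 := volume_le_volume_signedBall hn ε
  have h2 := two_pow_le_volume_signedBall hn0 ε
  have hT2 : ENNReal.ofReal ((l / (5 * n + 2)) ^ n * 2 ^ n) ≤ T := by
    rw [hvol, ENNReal.ofReal_mul (by positivity)]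
    gcongr
    simpa [ENNReal.ofReal_pow] using h2
  have hBT : volume B ≤ ENNReal.ofReal (1 / 10) * T := by
    have hΛ : 0 < ENNReal.ofReal (10 * ((5 * n + 2) / 2) ^ n) :=
      ENNReal.ofReal_pos.2 (by positivity)
    refine (ENNReal.mul_le_mul_iff_right hΛ.ne' ENNReal.ofReal_ne_top).1 (hBv.trans ?_)
    calc volume (box b fun _ => l) = ENNReal.ofReal (l ^ n) := by
          rw [volume_box, Finset.prod_const, Finset.card_univ, Fintype.card_fin,
            ENNReal.ofReal_pow hl.le]
      _ = ENNReal.ofReal (10 * ((5 * n + 2) / 2) ^ n) *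
          (ENNReal.ofReal (1 / 10) * ENNReal.ofReal ((l / (5 * n + 2)) ^ n * 2 ^ n)) := by
          rw [← ENNReal.ofReal_mul (by norm_num), ← ENNReal.ofReal_mul (by positivity)]
          congr 1
          rw [← mul_pow, mul_assoc, mul_left_comm, ← mul_assoc (10 : ℝ),
            show (10 : ℝ) * (1 / 10) = 1 by norm_num, one_mul, ← mul_pow]
          congr 1
          field_simp
      _ ≤ _ := by gcongr
  have hTt : T ≠ ∞ := by
    rw [hvol]
    refine ENNReal.mul_ne_top ENNReal.ofReal_ne_top (ne_top_of_le_ne_top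
      (volume_euclBall_ne_top hn0 (0 : Fin n → ℝ) (r := √n) (by positivity)) (measure_mono ?_))
    exact fun z hz => hz.1
  have hdiff : ENNReal.ofReal (9 / 10) * T ≤ volume (dilationNbhd b l y \ B) := by
    refine le_trans ?_ le_measure_sdiff
    refine le_trans ?_ (tsub_le_tsub_left hBT _)
    refine ENNReal.le_sub_of_add_le_right (ENNReal.mul_ne_top ENNReal.ofReal_ne_top hTt) ?_
    rw [← add_mul, ← ENNReal.ofReal_add (by norm_num) (by norm_num)]
    norm_num
    exact le_rfl
  refine le_trans ?_ hdiff
  rw [volume_euclBall hn0 _ (by positivity)] at h1 ⊢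
  rw [hvol]
  calc _ = ENNReal.ofReal (9 / 10) * (ENNReal.ofReal ((l / (5 * n + 2)) ^ n) *
      (ENNReal.ofReal (2 ^ (-(3 / 8 * n : ℝ))) * ENNReal.ofReal (√n ^ n * ballConst n))) := by
        have := ballConst_pos n
        rw [← ENNReal.ofReal_mul (by positivity), ← ENNReal.ofReal_mul (by positivity),
          ← ENNReal.ofReal_mul (by positivity), ← ENNReal.ofReal_mul (by positivity)]
        congr 1
        have : l / (5 * n + 2) = (1 + 2 / (5 * n : ℝ))⁻¹ * (l / (5 * n)) := by
          field_simp
        rw [this, mul_pow, mul_pow, inv_pow]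
        ring
    _ ≤ _ := by gcongr

/-- The maximal function has large integral over any cube, even off a small set. -/
lemma mul_lintegral_le_lintegral_HLMax_diff (hn : 3 ≤ n) (hw : Measurable w) (hl : 0 < l)
    {Q : Set (Fin n → ℝ)} (hSQ : (box b fun _ => l) ⊆ Q) {B : Set (Fin n → ℝ)}
    (hB : MeasurableSet B)
    (hBv : ENNReal.ofReal (10 * ((5 * n + 2) / 2) ^ n) * volume B ≤ volume (box b fun _ => l)) :
    ENNReal.ofReal (9 / 10 * 2 ^ (-(3 / 8 * n : ℝ)) * ((1 + 2 / (5 * n : ℝ)) ^ n)⁻¹) *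
      ∫⁻ y in box b fun _ => l, ENNReal.ofReal (w y) ≤
      ∫⁻ x in (box b fun _ => l) \ B, HLMax (Q.indicator w) x := by
  have hn0 : 0 < n := by omega
  have hn' : (0 : ℝ) < n := by exact_mod_cast hn0
  set S := box b fun _ => l with hS
  have hSm : MeasurableSet S := measurableSet_box _ _
  set r := l / (5 * n) * √n with hr
  have hr0 : 0 < r := by positivity
  set c : ℝ := 9 / 10 * 2 ^ (-(3 / 8 * n : ℝ)) * ((1 + 2 / (5 * n : ℝ)) ^ n)⁻¹
  set v := volume (euclBall (0 : Fin n → ℝ) r) with hv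
  have hv0 : v ≠ 0 := volume_euclBall_ne_zero hn0 _ hr0
  have hvt : v ≠ ∞ := volume_euclBall_ne_top hn0 _ hr0
  have hvc : ∀ x, volume (euclBall x r) = v := fun x => by
    rw [hv, volume_euclBall hn0 _ hr0, volume_euclBall hn0 _ hr0]
  set U : Set (Fin n → ℝ) := {x | ∀ i, |x i - (b i + l / 2)| < l / 2} with hU
  have hUm : MeasurableSet U := by
    have : U = ⋂ i, {x : Fin n → ℝ | |x i - (b i + l / 2)| < l / 2} := by ext; simp [hU]
    rw [this]
    exact MeasurableSet.iInter fun i =>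
      measurableSet_lt ((measurable_pi_apply i).sub_const _).abs measurable_const
  have hUS : U ⊆ S := fun x hx i _ => by
    have := abs_lt.1 (hx i)
    constructor <;> linarith [this.1, this.2]
  set f : (Fin n → ℝ) → (Fin n → ℝ) → ℝ≥0∞ := fun x =>
    (euclBall (cubeDilation b l x) r).indicator fun y => ENNReal.ofReal (w y) with hf
  have hfm : Measurable (Function.uncurry f) := by
    set E : Set ((Fin n → ℝ) × (Fin n → ℝ)) :=
      {q | ∑ i, (q.2 i - cubeDilation b l q.1 i) ^ 2 < r ^ 2} with hE
    have hEm : MeasurableSet E := by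
      refine measurableSet_lt (Finset.measurable_fun_sum _ fun i _ => ?_) measurable_const
      exact (((measurable_pi_apply i).comp measurable_snd).sub
        ((measurable_pi_apply i).comp (measurable_cubeDilation.comp measurable_fst))).pow_const 2
    have : Function.uncurry f = E.indicator fun q => ENNReal.ofReal (w q.2) := by
      funext q
      simp only [Function.uncurry, hf, Set.indicator, mem_euclBall hr0, hE, Set.mem_ofPred_eq]
    rw [this]
    exact (hw.comp measurable_snd).ennreal_ofReal.indicator hEm
  have hswap : ∫⁻ x in U \ B, ∫⁻ y in S, f x y = ∫⁻ y in S, ∫⁻ x in U \ B, f x y :=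
    lintegral_lintegral_swap hfm.aemeasurable
  have hlow : ∀ y ∈ S, ENNReal.ofReal c * v * ENNReal.ofReal (w y) ≤ ∫⁻ x in U \ B, f x y := by
    intro y hy
    calc ENNReal.ofReal c * v * ENNReal.ofReal (w y)
        ≤ volume (dilationNbhd b l y \ B) * ENNReal.ofReal (w y) := by
          gcongr
          exact le_volume_dilationNbhd_diff hn hl hBv y
      _ = ∫⁻ _ in dilationNbhd b l y \ B, ENNReal.ofReal (w y) := by
          rw [setLIntegral_const, mul_comm]
      _ = ∫⁻ x in dilationNbhd b l y \ B, f x y := by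
          refine setLIntegral_congr_fun ((measurableSet_dilationNbhd y).diff hB) fun x hx => ?_
          exact (Set.indicator_of_mem (dilationNbhd_spec hn hl hy hx.1).2
            fun y => ENNReal.ofReal (w y)).symm
      _ ≤ _ := lintegral_mono_set
          (Set.sdiff_subset_sdiff_left fun x hx => (dilationNbhd_spec hn hl hy hx).1)
  calc ENNReal.ofReal c * ∫⁻ y in S, ENNReal.ofReal (w y)
      = v⁻¹ * ∫⁻ y in S, ENNReal.ofReal c * v * ENNReal.ofReal (w y) := by
        rw [lintegral_const_mul' _ _ (ENNReal.mul_ne_top ENNReal.ofReal_ne_top hvt), ← mul_assoc,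
          mul_left_comm, ENNReal.inv_mul_cancel hv0 hvt, mul_one]
    _ ≤ v⁻¹ * ∫⁻ y in S, ∫⁻ x in U \ B, f x y := by
        gcongr v⁻¹ * ?_
        exact setLIntegral_mono' hSm hlow
    _ = ∫⁻ x in U \ B, v⁻¹ * ∫⁻ y in S, f x y := by
        rw [← hswap, lintegral_const_mul' _ _ (ENNReal.inv_ne_top.2 hv0)]
    _ ≤ ∫⁻ x in U \ B, HLMax (Q.indicator w) x := by
        refine setLIntegral_mono' (hUm.diff hB) fun x hx => ?_
        have := le_HLMax (w := w) hSm hSQ hr0 (mem_euclBall_cubeDilation hn0 hl hx.1)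
        rwa [hvc, ← setLIntegral_indicator (measurableSet_euclBall _ _)] at this
    _ ≤ _ := lintegral_mono_set (Set.sdiff_subset_sdiff_left hUS)

end RobustCube

lemma quadratic_le_two_rpow {n : ℕ} (hn : 10 ≤ n) :
    5 / 3 * (2.311 + 3.962 * (n : ℝ) + n * (5 * n - 50) / 52) + 0.347 * n + 0.5 ≤
      (2 : ℝ) ^ (5 / 8 * n : ℝ) := by
  induction n, hn using Nat.le_induction with
  | base =>
    have h : (74 : ℝ) ≤ 2 ^ (5 / 8 * (10 : ℕ) : ℝ) := by
      refine le_of_pow_le_pow_left₀ (n := 4) (by norm_num) (by positivity) ?_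
      rw [← Real.rpow_natCast, ← Real.rpow_natCast, ← Real.rpow_mul two_pos.le]
      norm_num
    refine le_trans ?_ h
    norm_num
  | succ n hn ih =>
    have hn' : (10 : ℝ) ≤ n := by exact_mod_cast hn
    have h : (3 / 2 : ℝ) ≤ 2 ^ (5 / 8 : ℝ) := by
      refine le_of_pow_le_pow_left₀ (n := 8) (by norm_num) (by positivity) ?_
      rw [← Real.rpow_natCast, ← Real.rpow_natCast, ← Real.rpow_mul two_pos.le]
      norm_num
    have he : (2 : ℝ) ^ (5 / 8 * (n + 1 : ℕ) : ℝ) = 2 ^ (5 / 8 * n : ℝ) * 2 ^ (5 / 8 : ℝ) := by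
      rw [← Real.rpow_add two_pos]
      congr 1
      push_cast
      ring
    have hp : (0 : ℝ) ≤ 2 ^ (5 / 8 * n : ℝ) := by positivity
    rw [he]
    push_cast
    nlinarith

lemma log_ten_le : Real.log 10 ≤ 2.311 := by
  have h : 3 * Real.log 10 ≤ 10 * Real.log 2 := by
    have := Real.log_le_log (by norm_num) (show (10 : ℝ) ^ 3 ≤ 2 ^ 10 by norm_num)
    rw [Real.log_pow, Real.log_pow] at this
    exact_mod_cast this
  linarith [Real.log_two_lt_d9]

lemma log_fifty_two_le : Real.log 52 ≤ 3.962 := by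
  have h : 7 * Real.log 52 ≤ 40 * Real.log 2 := by
    have := Real.log_le_log (by norm_num) (show (52 : ℝ) ^ 7 ≤ 2 ^ 40 by norm_num)
    rw [Real.log_pow, Real.log_pow] at this
    exact_mod_cast this
  linarith [Real.log_two_lt_d9]

lemma one_add_pow_le_three_halves {n : ℕ} (hn : 0 < n) : (1 + 2 / (5 * n : ℝ)) ^ n ≤ 3 / 2 := by
  have hn' : (0 : ℝ) < n := by exact_mod_cast hn
  have h1 : (1 + 2 / (5 * n : ℝ)) ^ n ≤ Real.exp (2 / 5) := by
    calc (1 + 2 / (5 * n : ℝ)) ^ n ≤ Real.exp (2 / (5 * n)) ^ n := by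
          gcongr
          linarith [Real.add_one_le_exp (2 / (5 * n : ℝ))]
      _ = Real.exp (2 / 5) := by
          rw [← Real.exp_nat_mul]
          congr 1
          field_simp
  refine h1.trans (le_of_pow_le_pow_left₀ (n := 5) (by norm_num) (by norm_num) ?_)
  rw [← Real.exp_nat_mul]
  have : Real.exp ((5 : ℕ) * (2 / 5)) = Real.exp 1 ^ 2 := by
    rw [← Real.exp_nat_mul]
    norm_num
  rw [this]
  calc Real.exp 1 ^ 2 ≤ 2.7182818286 ^ 2 := by gcongr; exact Real.exp_one_lt_d9.le
    _ ≤ _ := by norm_num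

lemma log_div_le_two_pow {n : ℕ} (hn : 10 ≤ n) :
    Real.log (2 ^ n * (10 * ((5 * n + 2) / 2) ^ n)) /
      (9 / 10 * 2 ^ (-(3 / 8 * n : ℝ)) * ((1 + 2 / (5 * n : ℝ)) ^ n)⁻¹) + n * Real.log 2 / 2 + 1 / 2 ≤
      2 ^ n := by
  have hn' : (10 : ℝ) ≤ n := by exact_mod_cast hn
  have hlog : Real.log (2 ^ n * (10 * ((5 * n + 2) / 2) ^ n)) ≤
      2.311 + 3.962 * n + n * (5 * n - 50) / 52 := by
    have h1 : (2 : ℝ) ^ n * (10 * ((5 * n + 2) / 2) ^ n) = 10 * (5 * n + 2) ^ n := by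
      rw [mul_left_comm, ← mul_pow]
      congr 2
      ring
    have h2 : Real.log (5 * n + 2) ≤ 3.962 + (5 * n - 50) / 52 := by
      have : (5 * n + 2 : ℝ) = 52 * ((5 * n + 2) / 52) := by ring
      rw [this, Real.log_mul (by norm_num) (by positivity)]
      have := Real.log_le_sub_one_of_pos (show (0 : ℝ) < (5 * n + 2) / 52 by positivity)
      linarith [log_fifty_two_le]
    rw [h1, Real.log_mul (by norm_num) (by positivity), Real.log_pow]
    have := mul_le_mul_of_nonneg_left h2 (show (0 : ℝ) ≤ n by linarith)
    linarith [log_ten_le]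
  have hlog0 : 0 ≤ Real.log (2 ^ n * (10 * ((5 * n + 2) / 2) ^ n)) := by
    refine Real.log_nonneg ?_
    have h1 : (1 : ℝ) ≤ 2 ^ n := one_le_pow₀ (by norm_num)
    have h2 : (1 : ℝ) ≤ ((5 * n + 2) / 2) ^ n := one_le_pow₀ (by linarith)
    nlinarith
  set A := Real.log (2 ^ n * (10 * ((5 * n + 2) / 2) ^ n))
  set P : ℝ := 2 ^ (3 / 8 * n : ℝ) with hP
  have hP1 : 1 ≤ P := Real.one_le_rpow (by norm_num) (by positivity)
  have hdiv : A / (9 / 10 * 2 ^ (-(3 / 8 * n : ℝ)) * ((1 + 2 / (5 * n : ℝ)) ^ n)⁻¹) ≤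
      P * (5 / 3 * (2.311 + 3.962 * n + n * (5 * n - 50) / 52)) := by
    have : A / (9 / 10 * 2 ^ (-(3 / 8 * n : ℝ)) * ((1 + 2 / (5 * n : ℝ)) ^ n)⁻¹) =
        P * (10 / 9 * (1 + 2 / (5 * n : ℝ)) ^ n * A) := by
      rw [Real.rpow_neg two_pos.le, ← hP]
      have : (1 + 2 / (5 * n : ℝ)) ^ n ≠ 0 := by positivity
      generalize (1 + 2 / (5 * n : ℝ)) ^ n = u at *
      field_simp
    rw [this]
    have h32 := one_add_pow_le_three_halves (n := n) (by omega)
    gcongr P * ?_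
    calc 10 / 9 * (1 + 2 / (5 * n : ℝ)) ^ n * A ≤ 10 / 9 * (3 / 2) * A := by gcongr
      _ ≤ 10 / 9 * (3 / 2) * (2.311 + 3.962 * n + n * (5 * n - 50) / 52) := by gcongr
      _ = _ := by ring
  have h2n : (2 : ℝ) ^ n = P * 2 ^ (5 / 8 * n : ℝ) := by
    rw [hP, ← Real.rpow_add two_pos, ← Real.rpow_natCast]
    congr 1
    ring
  have hq := quadratic_le_two_rpow hn
  have hsmall : (n : ℝ) * Real.log 2 / 2 + 1 / 2 ≤ P * (0.347 * n + 0.5) := by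
    have := Real.log_two_lt_d9
    nlinarith
  rw [h2n]
  nlinarith

lemma entropyBound_of_ten_le {n : ℕ} (hn : 10 ≤ n) {w : (Fin n → ℝ) → ℝ}
    (hw : Measurable w) (hpos : ∀ᵐ x, 0 < w x) (hloc : LocallyIntegrable w) {K : ℝ} (hK : 1 ≤ K)
    (hFW : ∀ Q : Set (Fin n → ℝ), IsCube Q →
      ∫⁻ x in Q, HLMax (Q.indicator w) x ≤
        ENNReal.ofReal K * ∫⁻ x in Q, ENNReal.ofReal (w x)) :
    ∃ C : ℝ, EntropyBound w C ∧ C + n * Real.log 2 / 2 ≤ 2 ^ n * K - 1 / 2 := by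
  have hn' : (10 : ℝ) ≤ n := by exact_mod_cast hn
  have hnum := log_div_le_two_pow hn
  set c : ℝ := 9 / 10 * 2 ^ (-(3 / 8 * n : ℝ)) * ((1 + 2 / (5 * n : ℝ)) ^ n)⁻¹ with hc
  have hc0 : 0 < c := by positivity
  set Λ : ℝ := 10 * ((5 * n + 2) / 2) ^ n with hΛ
  have h1Λ : 1 < Λ := by
    have : (1 : ℝ) ≤ ((5 * n + 2) / 2) ^ n := one_le_pow₀ (by linarith)
    linarith
  have hD : (1 : ℝ) ≤ 2 ^ n := one_le_pow₀ (by norm_num)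
  have hA : 0 ≤ Real.log (2 ^ n * Λ) := Real.log_nonneg (by nlinarith)
  refine ⟨Real.log (2 ^ n * Λ) / c * K, fun a l hl N => ?_, ?_⟩
  · have F := cellFiltration_cube (a := a) hw hpos hloc hl
    have hcell := cell_dyadicIdx_zero (a := a) (e := cubeExp) hl (fun i => by simp [cubeExp])
      (corner_mem_box hl)
    have h := F.lintegral_log_runMax_le_of_robust hw.ennreal_ofReal hD h1Λ (c := c)
      (f := HLMax ((Set.Icc a fun i => a i + l).indicator w)) a ?_ N
    · rw [hcell] at h
      have h2 := h.trans (mul_le_mul_right (lintegral_HLMax_box_le hFW a hl) _)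
      have hcE : ENNReal.ofReal c ≠ 0 := (ENNReal.ofReal_pos.2 hc0).ne'
      refine (ENNReal.mul_le_mul_iff_right hcE ENNReal.ofReal_ne_top).1 (h2.trans_eq ?_)
      generalize Real.log (2 ^ n * Λ) = A at hA ⊢
      rw [← mul_assoc, ← mul_assoc, ← ENNReal.ofReal_mul hA, ← ENNReal.ofReal_mul hc0.le]
      congr 2
      field_simp
    · intro k z hz B hB _ hBv
      have hzk : cell (dyadicIdx a l cubeExp) k z =
          box (fun i => a i + dyadicIdx a l cubeExp k z i * (l / 2 ^ k)) fun _ => l / 2 ^ k :=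
        cell_dyadicIdx hl k z
      have hsub : cell (dyadicIdx a l cubeExp) k z ⊆ Set.Icc a fun i => a i + l := by
        refine ((F.cell_subset (Nat.zero_le k) z).trans ?_).trans (box_subset_Icc a fun _ => l)
        rw [cell_dyadicIdx_zero hl (fun i => by simp [cubeExp]) (hcell ▸ hz)]
      rw [hzk] at hBv hsub ⊢
      exact mul_lintegral_le_lintegral_HLMax_diff (by omega) hw (by positivity) hsub hB hBv
  · have hAc : 0 ≤ Real.log (2 ^ n * Λ) / c := div_nonneg hA hc0.le
    have : 0 ≤ (n : ℝ) * Real.log 2 / 2 :=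
      div_nonneg (mul_nonneg (by linarith) (Real.log_nonneg one_le_two)) two_pos.le
    nlinarith

open scoped Topology

section Differentiation

variable {n : ℕ} {w : (Fin n → ℝ) → ℝ} {a : Fin n → ℝ} {l : ℝ}

lemma box_ae_eq_closedBall (b : Fin n → ℝ) {σ : ℝ} (hσ : 0 < σ) :
    box b (fun _ => σ) =ᵐ[volume] Metric.closedBall (fun i => b i + σ / 2) (σ / 2) := by
  have : Metric.closedBall (fun i => b i + σ / 2) (σ / 2) = Set.Icc b fun i => b i + σ := by
    rw [closedBall_pi _ (by positivity), ← Set.pi_univ_Icc]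
    congr 1
    funext i
    rw [Real.closedBall_eq_Icc]
    congr 1 <;> ring
  rw [this]
  exact box_ae_eq_Icc b fun _ => σ

/-- Averages over shrinking dyadic cubes converge almost everywhere. -/
lemma ae_tendsto_cellAvg (hpos : ∀ᵐ x, 0 < w x) (hloc : LocallyIntegrable w) (hl : 0 < l) :
    ∀ᵐ x, Filter.Tendsto (fun k => cellAvg volume (fun x => ENNReal.ofReal (w x))
      (dyadicIdx a l cubeExp) k x) Filter.atTop (𝓝 (w x)) := by
  filter_upwards [IsUnifLocDoublingMeasure.ae_tendsto_average (μ := volume) hloc 1] with x hx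
  set b : ℕ → Fin n → ℝ := fun k i => a i + dyadicIdx a l cubeExp k x i * (l / 2 ^ k)
  have hcell : ∀ k, cell (dyadicIdx a l cubeExp) k x = box (b k) fun _ => l / 2 ^ k :=
    fun k => cell_dyadicIdx hl k x
  have hδ : Filter.Tendsto (fun k : ℕ => l / 2 ^ k / 2) Filter.atTop (𝓝[>] 0) := by
    refine tendsto_nhdsWithin_iff.2 ⟨?_, Filter.Eventually.of_forall fun k => ?_⟩
    · have := (tendsto_pow_atTop_nhds_zero_of_lt_one (r := (1 / 2 : ℝ)) (by norm_num)
        (by norm_num)).const_mul (l / 2)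
      rw [mul_zero] at this
      refine this.congr fun k => ?_
      rw [one_div, inv_pow]
      ring
    · exact show 0 < l / 2 ^ k / 2 by positivity
  refine (hx (fun k i => b k i + l / 2 ^ k / 2) _ hδ (Filter.Eventually.of_forall fun k => ?_)).congr
    fun k => ?_
  · have hxk : x ∈ box (b k) fun _ => l / 2 ^ k := hcell k ▸ mem_cell_self k x
    rw [one_mul, mem_closedBall_iff_norm, pi_norm_le_iff_of_nonneg (by positivity)]
    intro i
    have := hxk i trivial
    rw [Pi.sub_apply, Real.norm_eq_abs, abs_le]
    constructor <;> linarith [this.1, this.2]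
  · have hσ : 0 < l / 2 ^ k := by positivity
    rw [← setAverage_congr (box_ae_eq_closedBall (b k) hσ), setAverage_eq, cellAvg, setAvg, hcell,
      integral_eq_lintegral_of_nonneg_ae (ae_restrict_of_ae (hpos.mono fun y hy => hy.le))
      hloc.aestronglyMeasurable.restrict, smul_eq_mul, Measure.real]
    exact inv_mul_eq_div _ _

end Differentiation

section ReverseHolder

variable {n : ℕ} {w : (Fin n → ℝ) → ℝ} {C : ℝ}

lemma EntropyBound.lintegral_cell_le (h : EntropyBound w C) {a : Fin n → ℝ} {l : ℝ} (hl : 0 < l)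
    (k m : ℕ) (x : Fin n → ℝ) :
    ∫⁻ y in cell (dyadicIdx a l cubeExp) k x, ENNReal.ofReal (w y) * ENNReal.ofReal (Real.log
      (runMax (fun j => cellAvg volume (fun x => ENNReal.ofReal (w x))
        (dyadicIdx a l cubeExp) (k + j)) m y /
        cellAvg volume (fun x => ENNReal.ofReal (w x)) (dyadicIdx a l cubeExp) k y)) ≤
      ENNReal.ofReal C * ∫⁻ y in cell (dyadicIdx a l cubeExp) k x, ENNReal.ofReal (w y) := by
  set p := dyadicIdx a l cubeExp k x with hp
  have hcell : cell (dyadicIdx a l cubeExp) k x =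
      box (fun i => a i + p i * (l / 2 ^ k)) fun _ => l / 2 ^ k := cell_dyadicIdx hl k x
  have havg : cellAvg volume (fun x => ENNReal.ofReal (w x))
      (dyadicIdx (fun i => a i + p i * (l / 2 ^ k)) (l / 2 ^ k) cubeExp) =
      fun j => cellAvg volume (fun x => ENNReal.ofReal (w x)) (dyadicIdx a l cubeExp) (k + j) := by
    funext j y
    rw [cellAvg, cell_subcube k j p y hl, cellAvg]
  have := h (fun i => a i + p i * (l / 2 ^ k)) (l / 2 ^ k) (by positivity) m
  rw [havg] at this
  rw [hcell]
  exact this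

/-- The reverse Hölder inequality on half-open cubes. -/
lemma EntropyBound.lintegral_rpow_le (h : EntropyBound w C) (hw : Measurable w)
    (hpos : ∀ᵐ x, 0 < w x) (hloc : LocallyIntegrable w) {s : ℝ} (hs : 0 ≤ s)
    (hsn : s * (n * Real.log 2) ≤ 1) (hsC : s * C * (1 + s * (n * Real.log 2)) ≤ 1 / 2)
    (a : Fin n → ℝ) {l : ℝ} (hl : 0 < l) :
    (volume (box a fun _ => l))⁻¹ * ∫⁻ x in box a fun _ => l, ENNReal.ofReal (w x) ^ (1 + s) ≤
      2 * ((volume (box a fun _ => l))⁻¹ *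
        ∫⁻ x in box a fun _ => l, ENNReal.ofReal (w x)) ^ (1 + s) := by
  have F := cellFiltration_cube (a := a) hw hpos hloc hl
  have hcell := cell_dyadicIdx_zero (a := a) (e := cubeExp) hl (fun i => by simp [cubeExp])
    (corner_mem_box hl)
  have hN := F.lintegral_rpow_runMax_le hw.ennreal_ofReal (one_le_pow₀ (by norm_num)) hs
    (by rwa [Real.log_pow]) (by rwa [Real.log_pow]) (h.lintegral_cell_le hl) a
  have hv0 := F.vol_ne_zero 0 a
  have hvt := F.vol_ne_top 0 a
  have hx0 := F.cellAvg_pos 0 a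
  have hmass := F.ofReal_cellAvg_mul 0 a
  have hconst : ∀ y ∈ cell (dyadicIdx a l cubeExp) 0 a,
      cellAvg volume (fun x => ENNReal.ofReal (w x)) (dyadicIdx a l cubeExp) 0 y =
      cellAvg volume (fun x => ENNReal.ofReal (w x)) (dyadicIdx a l cubeExp) 0 a :=
    fun y hy => F.cellAvg_congr le_rfl hy
  have hlim := ae_tendsto_cellAvg (a := a) hpos hloc hl
  have hSm := F.measurableSet_cell 0 a
  rw [← hcell]
  set S := cell (dyadicIdx a l cubeExp) 0 a
  set X := cellAvg volume (fun x => ENNReal.ofReal (w x)) (dyadicIdx a l cubeExp) with hX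
  set x₀ := X 0 a with hx₀
  set m := ∫⁻ x in S, ENNReal.ofReal (w x)
  have hm : (volume S)⁻¹ * m = ENNReal.ofReal x₀ := by
    rw [← hmass, mul_comm, mul_assoc, ENNReal.mul_inv_cancel hv0 hvt, mul_one]
  have hsup : ∫⁻ y in S, ⨆ N, ENNReal.ofReal (w y) *
      ENNReal.ofReal ((runMax X N y / X 0 y) ^ s) ≤ 2 * m := by
    rw [lintegral_iSup]
    · exact iSup_le hN
    · intro N
      exact hw.ennreal_ofReal.mul (((F.measurable_runMax N).div
        (F.measurable_cellAvg 0)).pow_const s).ennreal_ofReal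
    · intro N N' hNN y
      dsimp only
      have := F.cellAvg_pos 0 y
      have := F.runMax_pos N y
      gcongr
      exact runMax_mono hNN y
  have hpt : ∀ᵐ y ∂volume.restrict S, ENNReal.ofReal (w y) ^ (1 + s) ≤ ENNReal.ofReal x₀ ^ s *
      ⨆ N, ENNReal.ofReal (w y) * ENNReal.ofReal ((runMax X N y / X 0 y) ^ s) := by
    filter_upwards [ae_restrict_of_ae hpos, ae_restrict_of_ae hlim, ae_restrict_mem hSm]
      with y hy hyl hyS
    have hle : ENNReal.ofReal (w y) * ENNReal.ofReal ((w y / x₀) ^ s) ≤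
        ⨆ N, ENNReal.ofReal (w y) * ENNReal.ofReal ((runMax X N y / X 0 y) ^ s) := by
      have ht : Filter.Tendsto (fun N => ENNReal.ofReal (w y) * ENNReal.ofReal ((X N y / x₀) ^ s))
          Filter.atTop (𝓝 (ENNReal.ofReal (w y) * ENNReal.ofReal ((w y / x₀) ^ s))) := by
        refine ENNReal.Tendsto.const_mul (ENNReal.tendsto_ofReal ?_) (Or.inr ENNReal.ofReal_ne_top)
        exact (hyl.div_const x₀).rpow_const (Or.inr hs)
      refine le_of_tendsto' ht fun N => le_iSup_of_le N ?_
      rw [hconst y hyS]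
      have := F.cellAvg_pos N y
      gcongr
      exact le_runMax le_rfl y
    refine le_trans (le_of_eq ?_) (mul_le_mul_right hle _)
    rw [ENNReal.rpow_add _ _ (ENNReal.ofReal_pos.2 hy).ne' ENNReal.ofReal_ne_top,
      ENNReal.rpow_one, mul_left_comm, ← ENNReal.ofReal_rpow_of_pos (div_pos hy hx0),
      ← ENNReal.mul_rpow_of_nonneg _ _ hs, ← ENNReal.ofReal_mul hx0.le, mul_div_cancel₀ _ hx0.ne']
  have hxE : ENNReal.ofReal x₀ ≠ 0 := (ENNReal.ofReal_pos.2 hx0).ne'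
  calc (volume S)⁻¹ * ∫⁻ x in S, ENNReal.ofReal (w x) ^ (1 + s)
      ≤ (volume S)⁻¹ * (ENNReal.ofReal x₀ ^ s * (2 * m)) := by
        gcongr
        refine (lintegral_mono_ae hpt).trans ?_
        rw [lintegral_const_mul' _ _ (ENNReal.rpow_ne_top_of_nonneg hs ENNReal.ofReal_ne_top)]
        gcongr
    _ = 2 * (((volume S)⁻¹ * m) * ENNReal.ofReal x₀ ^ s) := by ring
    _ = _ := by
        rw [hm, ENNReal.rpow_add _ _ hxE ENNReal.ofReal_ne_top, ENNReal.rpow_one]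

end ReverseHolder

/-- Sharp reverse Hölder inequality for `A_∞` weights with Fujii–Wilson constant at most `K`:
for `1 ≤ r ≤ 1 + 1/(2^{n+1}K - 1)` and every cube `Q`,
`⨍_Q w^r ≤ 2 (⨍_Q w)^r`. -/
theorem reverse_holder_of_fujiiWilson {n : ℕ} (w : (Fin n → ℝ) → ℝ) (hw : Measurable w)
    (hpos : ∀ᵐ x, 0 < w x) (hloc : LocallyIntegrable w)
    (K : ℝ) (hK : 1 ≤ K)
    (hFW : ∀ Q : Set (Fin n → ℝ), IsCube Q →
      ∫⁻ x in Q, HLMax (Q.indicator w) x ≤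
        ENNReal.ofReal K * ∫⁻ x in Q, ENNReal.ofReal (w x))
    (r : ℝ) (hr1 : 1 ≤ r) (hr2 : r ≤ 1 + 1 / (2 ^ (n + 1) * K - 1)) :
    ∀ Q : Set (Fin n → ℝ), IsCube Q →
      (volume Q)⁻¹ * ∫⁻ x in Q, ENNReal.ofReal (w x) ^ r ≤
        2 * ((volume Q)⁻¹ * ∫⁻ x in Q, ENNReal.ofReal (w x)) ^ r := by
  rintro Q ⟨a, l, hl, rfl⟩
  rcases Nat.eq_zero_or_pos n with rfl | hn
  · have hQ : (Set.Icc a fun i => a i + l) = {a} := by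
      ext x
      simp [Subsingleton.elim x a]
    have hv : volume ({a} : Set (Fin 0 → ℝ)) = 1 := by
      rw [Measure.volume_pi_eq_dirac a]
      simp
    rw [hQ, lintegral_singleton, lintegral_singleton, hv]
    simp only [inv_one, one_mul, mul_one]
    exact le_mul_of_one_le_left' one_le_two
  · obtain ⟨C, hC, hCK⟩ :
        ∃ C : ℝ, EntropyBound w C ∧ C + n * Real.log 2 / 2 ≤ 2 ^ n * K - 1 / 2 := by
      rcases Nat.lt_or_ge n 10 with h | h
      · exact entropyBound_of_le_nine hn (by omega) hw hpos hloc hK hFW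
      · exact entropyBound_of_ten_le h hw hpos hloc hK hFW
    obtain ⟨s, rfl⟩ : ∃ s, r = 1 + s := ⟨r - 1, by ring⟩
    have hs : 0 ≤ s := by linarith
    set u : ℝ := 2 ^ (n + 1) * K - 1 with hu
    set d : ℝ := n * Real.log 2 with hd
    have hd0 : 0 ≤ d := mul_nonneg (Nat.cast_nonneg n) (Real.log_nonneg one_le_two)
    have hdn : d ≤ n := by
      have := Real.log_two_lt_d9
      have : (0 : ℝ) ≤ n := Nat.cast_nonneg n
      rw [hd]
      nlinarith
    have hpow : (n : ℝ) + 1 ≤ 2 ^ n := by exact_mod_cast Nat.lt_two_pow_self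
    have hLu : u = 2 * (2 ^ n * K) - 1 := by rw [hu, pow_succ]; ring
    have hdu : d < u := by nlinarith
    have hu0 : 0 < u := by linarith
    have hsu : s ≤ 1 / u := by linarith
    have hsu' : s * u ≤ 1 := by rwa [le_div_iff₀ hu0] at hsu
    have hsd : s * d ≤ 1 := (mul_le_mul_of_nonneg_left hdu.le hs).trans hsu'
    have hsC : s * C * (1 + s * d) ≤ 1 / 2 := by
      have h1 : s * C ≤ (1 - s * d) / 2 := by nlinarith
      have h2 : 0 ≤ 1 + s * d := by positivity
      nlinarith [sq_nonneg (s * d), mul_le_mul_of_nonneg_right h1 h2]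
    have := hC.lintegral_rpow_le hw hpos hloc hs hsd hsC a hl
    have hae := box_ae_eq_Icc a fun _ => l
    rwa [measure_congr hae, setLIntegral_congr hae, setLIntegral_congr hae] at this
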